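/- arXiv:1703.05441 — 10 statements merged into one kernel-verified Lean document; each statement's English description precedes it below -/
import Mathlib

section
/- Let B be an N×N Hermitian negative definite complex matrix and let V be an N×n complex matrix with linearly independent columns (1 ≤ n ≤ N). Then V*BV is invertible, the matrix B̃ := BV(V*BV)⁻¹V*B is Hermitian of rank exactly n, and B̃x = Bx for every x in the column span of V. Moreover B̃ is the unique Hermitian N×N matrix of rank at most n that agrees with B on the column span of V. -/
open Matrix
open scoped ComplexOrder

/-- If multiplying `A` on the right by `V` does not lower its rank, then `A` factors through
`A * V`. -/
theorem Matrix.exists_eq_mul_of_rank_le_rank_mul {K l m n : Type*} [Field K] [Fintype l]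
    [Fintype m] [DecidableEq m] [Fintype n] (A : Matrix l m K) (V : Matrix m n K)
    (h : A.rank ≤ (A * V).rank) : ∃ C : Matrix n m K, A = A * V * C := by
  have hle : (A * V).mulVecLin.range ≤ A.mulVecLin.range := by
    rw [Matrix.mulVecLin_mul]
    exact LinearMap.range_comp_le_range _ _
  have heq := Submodule.eq_of_le_of_finrank_le hle h
  have hcol (j : m) : ∃ c : n → K, (A * V) *ᵥ c = A.col j := by
    have hmem : A *ᵥ Pi.single j 1 ∈ (A * V).mulVecLin.range := heq ▸ ⟨Pi.single j 1, rfl⟩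
    simpa using hmem
  choose c hc using hcol
  refine ⟨(Matrix.of c)ᵀ, ?_⟩
  ext i j
  exact (congrFun (hc j) i).symm

/-- **Optimality of the adaptive compression (Theorem 1 / Prop. `axiomaticI`).**
For a Hermitian negative definite `B` and `V` with linearly independent columns,
`V*BV` is invertible, `B̃ := BV(V*BV)⁻¹V*B` is Hermitian of rank exactly `n`, agrees
with `B` on the column span of `V`, and is the unique Hermitian matrix of rank at most
`n` with this agreement property. -/
theorem adaptive_compression_optimality {N n : ℕ} (hn1 : 1 ≤ n) (hnN : n ≤ N)
    (B : Matrix (Fin N) (Fin N) ℂ) (hB : B.IsHermitian) (hBneg : (-B).PosDef)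
    (V : Matrix (Fin N) (Fin n) ℂ)
    (hV : LinearIndependent ℂ (fun j : Fin n => Vᵀ j)) :
    IsUnit (Vᴴ * B * V) ∧
    (B * V * (Vᴴ * B * V)⁻¹ * Vᴴ * B).IsHermitian ∧
    (B * V * (Vᴴ * B * V)⁻¹ * Vᴴ * B).rank = n ∧
    (∀ c : Fin n → ℂ,
      (B * V * (Vᴴ * B * V)⁻¹ * Vᴴ * B).mulVec (V.mulVec c) = B.mulVec (V.mulVec c)) ∧
    (∀ B' : Matrix (Fin N) (Fin N) ℂ, B'.IsHermitian → B'.rank ≤ n →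
      (∀ c : Fin n → ℂ, B'.mulVec (V.mulVec c) = B.mulVec (V.mulVec c)) →
      B' = B * V * (Vᴴ * B * V)⁻¹ * Vᴴ * B) := by
  have hinj : Function.Injective V.mulVec := Matrix.mulVec_injective_iff.mpr hV
  have hM : IsUnit (Vᴴ * B * V) := by
    have h := (hBneg.conjTranspose_mul_mul_same hinj).isUnit
    simpa only [Matrix.mul_neg, Matrix.neg_mul, IsUnit.neg_iff] using h
  have hdet : IsUnit (Vᴴ * B * V).det := (Matrix.isUnit_iff_isUnit_det _).mp hM
  have hagree : B * V * (Vᴴ * B * V)⁻¹ * Vᴴ * B * V = B * V := by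
    rw [Matrix.mul_assoc _ Vᴴ B, Matrix.mul_assoc _ (Vᴴ * B) V,
      Matrix.nonsing_inv_mul_cancel_right _ _ hdet]
  have hrank : n ≤ (B * V).rank := by
    have h := Matrix.rank_mul_le_right Vᴴ (B * V)
    rwa [← Matrix.mul_assoc, Matrix.rank_of_isUnit _ hM, Fintype.card_fin] at h
  refine ⟨hM, ?_, le_antisymm ?_ ?_, fun c => ?_, fun B' hB' hrank' hagree' => ?_⟩
  · have hBH : Bᴴ = B := hB
    simp only [Matrix.IsHermitian, Matrix.conjTranspose_mul, Matrix.conjTranspose_nonsing_inv,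
      Matrix.conjTranspose_conjTranspose, hBH, Matrix.mul_assoc]
  · rw [Matrix.mul_assoc _ Vᴴ B]
    exact (Matrix.rank_mul_le_right _ _).trans (Matrix.rank_le_height _)
  · have h := Matrix.rank_mul_le_left (B * V * (Vᴴ * B * V)⁻¹ * Vᴴ * B) V
    rw [hagree] at h
    exact hrank.trans h
  · rw [Matrix.mulVec_mulVec, hagree, Matrix.mulVec_mulVec]
  · have hBV : B' * V = B * V := by
      refine Matrix.ext_iff_mulVec.mpr fun c => ?_
      simpa only [Matrix.mulVec_mulVec] using hagree' c
    have hVB : Vᴴ * B' = Vᴴ * B := by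
      simpa only [Matrix.conjTranspose_mul, hB.eq, hB'.eq] using
        congrArg Matrix.conjTranspose hBV
    obtain ⟨C, hC⟩ := Matrix.exists_eq_mul_of_rank_le_rank_mul B' V
      (hrank'.trans (hBV ▸ hrank))
    rw [hBV] at hC
    have hMC : Vᴴ * B * V * C = Vᴴ * B := by
      rw [Matrix.mul_assoc Vᴴ, Matrix.mul_assoc Vᴴ, ← hC, hVB]
    have hCeq : C = (Vᴴ * B * V)⁻¹ * (Vᴴ * B) := by
      exact (Matrix.nonsing_inv_mul_cancel_left _ C hdet).symm.trans (congrArg _ hMC)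
    rw [hC, hCeq]
    simp only [Matrix.mul_assoc]
end

section
/- Let B be an N×N Hermitian negative definite complex matrix and let Q be a rank-n orthogonal projector on ℂ^N (1 ≤ n ≤ N). Then the adaptive compression B̃[Q] satisfies B̃[Q] − B ⪰ 0 and B̃[Q] ⪯ 0; that is, B ⪯ B̃[Q] ⪯ 0 in the Loewner order. -/
open Matrix
open scoped ComplexOrder

/-- The `i`-th smallest eigenvalue (1-indexed, counted with multiplicity) of a
Hermitian matrix `H`; junk value `0` otherwise. -/
noncomputable def eig {N : ℕ} (H : Matrix (Fin N) (Fin N) ℂ) (i : ℕ) : ℝ :=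
  if hH : H.IsHermitian then
    if hi : i - 1 < N then hH.eigenvalues (Tuple.sort hH.eigenvalues ⟨i - 1, hi⟩) else 0
  else 0

/-- The adaptive compression `B̃[Q] = B (QBQ + (I-Q))⁻¹ B - B (I-Q) B`. -/
noncomputable def acomp {N : ℕ} (B Q : Matrix (Fin N) (Fin N) ℂ) : Matrix (Fin N) (Fin N) ℂ :=
  B * (Q * B * Q + (1 - Q))⁻¹ * B - B * (1 - Q) * B

/-- `Q` is a rank-`n` orthogonal projector (Hermitian, idempotent, rank `n`). -/
def IsProjOfRank {N : ℕ} (n : ℕ) (Q : Matrix (Fin N) (Fin N) ℂ) : Prop :=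
  Q.IsHermitian ∧ Q * Q = Q ∧ Q.rank = n

/-- `R` is a bottom-`n` eigenprojector of the Hermitian matrix `H`: a rank-`n`
orthogonal projector commuting with `H` whose range lies in the span of eigenvectors
for the `n` smallest eigenvalues, i.e. `x*Hx ≤ λ_n{H}·x*x` on the range of `R`. -/
def IsBottomEigenproj {N : ℕ} (n : ℕ) (H R : Matrix (Fin N) (Fin N) ℂ) : Prop :=
  IsProjOfRank n R ∧ H * R = R * H ∧
    ∀ x : Fin N → ℂ, (∃ y, x = R.mulVec y) →
      (star x ⬝ᵥ H.mulVec x).re ≤ eig H n * (star x ⬝ᵥ x).re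

/-- The spectral (operator) norm of a complex matrix: the operator norm of the
associated linear map on Euclidean space. -/
noncomputable def specNorm {N : ℕ} (M : Matrix (Fin N) (Fin N) ℂ) : ℝ :=
  ‖LinearMap.toContinuousLinearMap (Matrix.toEuclideanLin M)‖

section AdaptiveCompression

variable {N : ℕ} {B Q : Matrix (Fin N) (Fin N) ℂ}

lemma isUnit_compression_add_compl (hB : (-B).PosDef) (hQ : Q.IsHermitian) (hQQ : Q * Q = Q) :
    IsUnit (Q * B * Q + (1 - Q)) := by
  rw [← mulVec_injective_iff_isUnit, ← coe_mulVecLin, injective_iff_map_eq_zero]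
  intro x hx
  rw [mulVecLin_apply] at hx
  have hx₁ : Q *ᵥ x = x := by
    have h : (1 - Q) * (Q * B * Q + (1 - Q)) = 1 - Q := by
      simp only [mul_add, sub_mul, mul_sub, one_mul, mul_one, ← mul_assoc, hQQ]
      abel
    have h' : (1 - Q) *ᵥ x = 0 := by rw [← h, ← mulVec_mulVec, hx, mulVec_zero]
    rw [sub_mulVec, one_mulVec, sub_eq_zero] at h'
    exact h'.symm
  have hx₂ : Q *ᵥ B *ᵥ x = 0 := by
    simpa [add_mulVec, sub_mulVec, ← mulVec_mulVec, hx₁] using hx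
  by_contra hne
  refine (hB.dotProduct_mulVec_pos hne).ne' ?_
  have hs : star x = star x ᵥ* Q := by
    conv_lhs => rw [← hx₁, star_mulVec, hQ.eq]
  rw [hs, ← dotProduct_mulVec, neg_mulVec, mulVec_neg, hx₂, neg_zero, dotProduct_zero]

/-- The adaptive compression has the form `B K B`, with `K` a Hermitian reflexive generalized
inverse of `Q B Q`. -/
lemma exists_acomp_eq_mul_mul (hB : (-B).PosDef) (hQ : Q.IsHermitian) (hQQ : Q * Q = Q) :
    ∃ K : Matrix (Fin N) (Fin N) ℂ, K.IsHermitian ∧ K * B * K = K ∧ acomp B Q = B * K * B := by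
  have hBh : B.IsHermitian := by simpa using hB.isHermitian.neg
  have hdet := (isUnit_iff_isUnit_det _).mp (isUnit_compression_add_compl hB hQ hQQ)
  have hM : (Q * B * Q + (1 - Q)).IsHermitian := by
    refine IsHermitian.add ?_ (isHermitian_one.sub hQ)
    simp only [IsHermitian, conjTranspose_mul, hQ.eq, hBh.eq, mul_assoc]
  set M := Q * B * Q + (1 - Q) with hMdef
  have hQM : Q * M = Q * B * Q := by
    simp only [hMdef, mul_add, mul_sub, mul_one, ← mul_assoc, hQQ, sub_self, add_zero]
  have hMQ : M * Q = Q * B * Q := by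
    simp only [hMdef, add_mul, sub_mul, one_mul, mul_assoc, hQQ, sub_self, add_zero]
  have hl : M⁻¹ - (1 - Q) = M⁻¹ * Q := by
    have h : M * (1 - Q) = 1 - Q := by rw [mul_sub, mul_one, hMQ, hMdef]; abel
    have h' := nonsing_inv_mul_cancel_left M (1 - Q) hdet
    rw [h, mul_sub, mul_one] at h'
    rw [← h']; abel
  have hr : M⁻¹ - (1 - Q) = Q * M⁻¹ := by
    have h : (1 - Q) * M = 1 - Q := by rw [sub_mul, one_mul, hQM, hMdef]; abel
    have h' := mul_nonsing_inv_cancel_right M (1 - Q) hdet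
    rw [h, sub_mul, one_mul] at h'
    rw [← h']; abel
  refine ⟨M⁻¹ - (1 - Q), hM.inv.sub (isHermitian_one.sub hQ), ?_, ?_⟩
  · calc (M⁻¹ - (1 - Q)) * B * (M⁻¹ - (1 - Q)) = (M⁻¹ * Q) * B * (Q * M⁻¹) := by
          rw [← hl, ← hr]
      _ = M⁻¹ * (Q * B * Q) * M⁻¹ := by simp only [mul_assoc]
      _ = M⁻¹ - (1 - Q) := by rw [← hMQ, nonsing_inv_mul_cancel_left _ _ hdet, hr]
  · rw [acomp, ← hMdef, mul_sub B M⁻¹, sub_mul]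

end AdaptiveCompression

/-- **Lemma `negdef`.** For `B` Hermitian negative definite and `Q` a rank-`n`
orthogonal projector, `B ⪯ B̃[Q] ⪯ 0` in the Loewner order. -/
theorem acomp_loewner_between {N n : ℕ} (hn1 : 1 ≤ n) (hnN : n ≤ N)
    (B : Matrix (Fin N) (Fin N) ℂ) (hB : (-B).PosDef)
    (Q : Matrix (Fin N) (Fin N) ℂ) (hQ : IsProjOfRank n Q) :
    (acomp B Q - B).PosSemidef ∧ (-(acomp B Q)).PosSemidef := by
  obtain ⟨hQh, hQQ, -⟩ := hQ
  obtain ⟨K, hK, hKBK, hacomp⟩ := exists_acomp_eq_mul_mul hB hQh hQQ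
  have hBh : B.IsHermitian := by simpa using hB.isHermitian.neg
  have hBKB : B * K * B * K * B = B * K * B := by
    rw [mul_assoc B K B, mul_assoc B (K * B) K, hKBK, mul_assoc]
  rw [hacomp]
  constructor
  · convert hB.posSemidef.conjTranspose_mul_mul_same (1 - K * B) using 1
    simp only [conjTranspose_sub, conjTranspose_one, conjTranspose_mul, hK.eq, hBh.eq, sub_mul,
      mul_sub, one_mul, mul_one, mul_neg, neg_mul, ← mul_assoc, hBKB]
    abel
  · convert hB.posSemidef.conjTranspose_mul_mul_same (K * B) using 1
    simp only [conjTranspose_mul, hK.eq, hBh.eq, mul_neg, neg_mul, ← mul_assoc, hBKB]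
end

section
/- Let B be an N×N Hermitian negative definite complex matrix, let Q be a rank-n orthogonal projector on ℂ^N (1 ≤ n ≤ N), and let V be any N×n matrix whose columns form an orthonormal basis of the range of Q. Then QBQ + (I−Q) is invertible, V*BV is invertible, and BV(V*BV)⁻¹V*B = B(QBQ + (I−Q))⁻¹B − B(I−Q)B. In particular, BV(V*BV)⁻¹V*B depends only on the projector Q and not on the choice of orthonormal basis V. -/
open Matrix
open scoped ComplexOrder

/-- If the columns of `V` form an orthonormal basis of the range of the projector `Q` and the
compression `VᴴBV` is invertible, then `V(VᴴBV)⁻¹Vᴴ + (1 - Q)` is a right inverse of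
`QBQ + (1 - Q)`. -/
theorem projector_compression_mul_inv {R m k : Type*} [CommRing R] [StarRing R]
    [Fintype m] [DecidableEq m] [Fintype k] [DecidableEq k]
    {B Q : Matrix m m R} {V : Matrix m k R}
    (hV : Vᴴ * V = 1) (hVQ : V * Vᴴ = Q) (hW : IsUnit (Vᴴ * B * V)) :
    (Q * B * Q + (1 - Q)) * (V * (Vᴴ * B * V)⁻¹ * Vᴴ + (1 - Q)) = 1 := by
  have hdet := (Matrix.isUnit_iff_isUnit_det _).mp hW
  have hQV : Q * V = V := by rw [← hVQ, Matrix.mul_assoc, hV, Matrix.mul_one]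
  have hQQ : Q * Q = Q := by
    nth_rw 2 [← hVQ]
    rw [← Matrix.mul_assoc, hQV, hVQ]
  have hcompl : (1 - Q) * V = 0 := by rw [Matrix.sub_mul, Matrix.one_mul, hQV, sub_self]
  have hQcompl : Q * (1 - Q) = 0 := by rw [mul_sub, mul_one, hQQ, sub_self]
  have hcompl_sq : (1 - Q) * (1 - Q) = 1 - Q := by
    rw [sub_mul, one_mul, hQcompl, sub_zero]
  have hmain : Q * B * Q * (V * (Vᴴ * B * V)⁻¹ * Vᴴ) = Q := by
    calc Q * B * Q * (V * (Vᴴ * B * V)⁻¹ * Vᴴ)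
        = Q * B * (Q * V) * (Vᴴ * B * V)⁻¹ * Vᴴ := by simp only [Matrix.mul_assoc]
      _ = V * ((Vᴴ * B * V) * (Vᴴ * B * V)⁻¹) * Vᴴ := by
        rw [hQV]
        nth_rw 1 [← hVQ]
        simp only [Matrix.mul_assoc]
      _ = Q := by rw [Matrix.mul_nonsing_inv _ hdet, Matrix.mul_one, hVQ]
  rw [add_mul, mul_add, mul_add, hmain, hcompl_sq, Matrix.mul_assoc (Q * B), hQcompl,
    Matrix.mul_zero, add_zero, ← Matrix.mul_assoc, ← Matrix.mul_assoc, hcompl,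
    Matrix.zero_mul, Matrix.zero_mul, zero_add, add_sub_cancel]

/-- **Equivalence of the two formulas for the adaptive compression (Eq. (4.3) and
Remark on smoothness).** If the columns of `V` form an orthonormal basis of the range of
the rank-`n` orthogonal projector `Q` (i.e. `VᴴV = I` and `VVᴴ = Q`), then
`QBQ + (I-Q)` and `VᴴBV` are invertible and
`BV(VᴴBV)⁻¹VᴴB = B(QBQ + (I-Q))⁻¹B - B(I-Q)B`; in particular the left-hand side
depends only on `Q`, not on the choice of `V`. -/
theorem acomp_eq_basis_formula {N n : ℕ} (hn1 : 1 ≤ n) (hnN : n ≤ N)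
    (B : Matrix (Fin N) (Fin N) ℂ) (hB : (-B).PosDef)
    (Q : Matrix (Fin N) (Fin N) ℂ) (hQ : IsProjOfRank n Q)
    (V : Matrix (Fin N) (Fin n) ℂ) (hVortho : Vᴴ * V = 1) (hVQ : V * Vᴴ = Q) :
    IsUnit (Q * B * Q + (1 - Q)) ∧ IsUnit (Vᴴ * B * V) ∧
    B * V * (Vᴴ * B * V)⁻¹ * Vᴴ * B =
      B * (Q * B * Q + (1 - Q))⁻¹ * B - B * (1 - Q) * B := by
  have hW : IsUnit (Vᴴ * B * V) := by
    have hinj : Function.Injective V.mulVec := Function.LeftInverse.injective (g := Vᴴ.mulVec)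
      fun x => by rw [Matrix.mulVec_mulVec, hVortho, Matrix.one_mulVec]
    have h := (hB.conjTranspose_mul_mul_same hinj).isUnit
    rwa [Matrix.mul_neg, Matrix.neg_mul, IsUnit.neg_iff] at h
  have hinv := projector_compression_mul_inv hVortho hVQ hW
  exact ⟨IsUnit.of_mul_eq_one _ hinv, hW, by
    rw [Matrix.inv_eq_right_inv hinv, mul_add, add_mul, add_sub_cancel_right]
    simp only [Matrix.mul_assoc]⟩
end

section
/- Let A and B be N×N Hermitian complex matrices with B negative definite, let 1 ≤ n < N, and assume the spectral gap λ_n{A+B} < λ_{n+1}{A+B}. Let P be the bottom-n eigenprojector of A+B (which is unique by the gap assumption). Then: (i) λ_i{A+B̃[P]} ≥ λ_i{A+B} for every i = 1,…,N; (ii) λ_i{A+B̃[P]} = λ_i{A+B} for every i = 1,…,n; and (iii) P is the unique bottom-n eigenprojector of A+B̃[P]. -/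
open Matrix
open scoped ComplexOrder

/-- The quadratic form of `H` at `x`. -/
noncomputable def quadForm {N : ℕ} (H : Matrix (Fin N) (Fin N) ℂ) (x : Fin N → ℂ) : ℝ :=
  (star x ⬝ᵥ H.mulVec x).re

/-- The squared Euclidean norm of `x`. -/
noncomputable def sqNorm {N : ℕ} (x : Fin N → ℂ) : ℝ := (star x ⬝ᵥ x).re

lemma sqNorm_eq_sum {N : ℕ} (x : Fin N → ℂ) : sqNorm x = ∑ k, Complex.normSq (x k) := by
  simp [sqNorm, dotProduct, Complex.normSq_apply]

lemma sqNorm_pos {N : ℕ} {x : Fin N → ℂ} (hx : x ≠ 0) : 0 < sqNorm x := by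
  rw [sqNorm_eq_sum]
  obtain ⟨k, hk⟩ := Function.ne_iff.mp hx
  exact Finset.sum_pos' (fun k _ => Complex.normSq_nonneg _)
    ⟨k, Finset.mem_univ k, Complex.normSq_pos.mpr hk⟩

lemma eig_mono {N : ℕ} {H : Matrix (Fin N) (Fin N) ℂ} (hH : H.IsHermitian) {k l : ℕ}
    (hkl : k ≤ l) (hl : l < N) : eig H (k + 1) ≤ eig H (l + 1) := by
  have hk : k < N := by omega
  simp only [eig, hH, dif_pos, Nat.add_sub_cancel, hk, hl]
  exact Tuple.monotone_sort hH.eigenvalues (show (⟨k, hk⟩ : Fin N) ≤ ⟨l, hl⟩ from hkl)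

/-- `U` unitarily diagonalizes `H` with the eigenvalues in increasing order. -/
structure IsSortedDiag {N : ℕ} (H U : Matrix (Fin N) (Fin N) ℂ) : Prop where
  left : Uᴴ * U = 1
  right : U * Uᴴ = 1
  eq : H = U * diagonal (fun k : Fin N => (eig H (k + 1) : ℂ)) * Uᴴ

lemma exists_isSortedDiag {N : ℕ} {H : Matrix (Fin N) (Fin N) ℂ} (hH : H.IsHermitian) :
    ∃ U, IsSortedDiag H U := by
  set σ := Tuple.sort hH.eigenvalues with hσ
  set V : Matrix (Fin N) (Fin N) ℂ := hH.eigenvectorUnitary.1 with hV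
  have h1 : Vᴴ * V = 1 := by
    simpa [star_eq_conjTranspose] using Unitary.coe_star_mul_self hH.eigenvectorUnitary
  have h2 : V * Vᴴ = 1 := by
    simpa [star_eq_conjTranspose] using Unitary.coe_mul_star_self hH.eigenvectorUnitary
  have h3 : H = V * diagonal (fun k => (hH.eigenvalues k : ℂ)) * Vᴴ := by
    have := hH.spectral_theorem
    rw [Unitary.conjStarAlgAut_apply] at this
    simpa [star_eq_conjTranspose, Function.comp_def] using this
  have hD : diagonal (fun k : Fin N => (eig H (k + 1) : ℂ)) =
      (diagonal (fun k => (hH.eigenvalues k : ℂ))).submatrix σ σ := by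
    rw [submatrix_diagonal_equiv]
    congr 1
    ext k
    simp [eig, hH, hσ]
  refine ⟨V.submatrix id σ, ?_, ?_, ?_⟩
  · rw [conjTranspose_submatrix, ← submatrix_mul _ _ _ id _ Function.bijective_id, h1]
    simp
  · rw [conjTranspose_submatrix, ← submatrix_mul _ _ _ _ _ σ.bijective, h2]
    simp
  · rw [hD, conjTranspose_submatrix, ← submatrix_mul _ _ _ _ _ σ.bijective,
      ← submatrix_mul _ _ _ _ _ σ.bijective, ← h3]
    simp

namespace IsSortedDiag

variable {N : ℕ} {H U : Matrix (Fin N) (Fin N) ℂ}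

lemma sqNorm_eq (h : IsSortedDiag H U) (x : Fin N → ℂ) :
    sqNorm x = ∑ k, Complex.normSq ((Uᴴ *ᵥ x) k) := by
  rw [← sqNorm_eq_sum, sqNorm, sqNorm, star_mulVec, conjTranspose_conjTranspose,
    dotProduct_mulVec, vecMul_vecMul, h.right, vecMul_one]

lemma quadForm_eq (h : IsSortedDiag H U) (x : Fin N → ℂ) :
    quadForm H x = ∑ k : Fin N, eig H (k + 1) * Complex.normSq ((Uᴴ *ᵥ x) k) := by
  have key : star x ⬝ᵥ H *ᵥ x = star (Uᴴ *ᵥ x) ⬝ᵥ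
      diagonal (fun k : Fin N => (eig H (k + 1) : ℂ)) *ᵥ (Uᴴ *ᵥ x) := by
    conv_lhs => rw [h.eq]
    rw [star_mulVec, conjTranspose_conjTranspose, ← dotProduct_mulVec]
    simp only [mulVec_mulVec, Matrix.mul_assoc]
  rw [quadForm, key]
  simp only [dotProduct, mulVec_diagonal, Complex.re_sum]
  refine Finset.sum_congr rfl fun k _ => ?_
  simp [Complex.normSq_apply]
  ring

end IsSortedDiag

/-- The kernel of the coordinate functionals of `Uᴴ` outside of the first `i` indices. -/
def bottomSpace {N : ℕ} (U : Matrix (Fin N) (Fin N) ℂ) (i : ℕ) : Submodule ℂ (Fin N → ℂ) where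
  carrier := {x | ∀ k : Fin N, i ≤ k → (Uᴴ *ᵥ x) k = 0}
  add_mem' := fun {x y} hx hy k hk => by simp [mulVec_add, hx k hk, hy k hk]
  zero_mem' := fun k _ => by simp
  smul_mem' := fun a x hx k hk => by simp [mulVec_smul, hx k hk]

lemma le_finrank_bottomSpace {N : ℕ} (U : Matrix (Fin N) (Fin N) ℂ) {i : ℕ} (hi : i ≤ N) :
    i ≤ Module.finrank ℂ (bottomSpace U i) := by
  let L : (Fin N → ℂ) →ₗ[ℂ] (Fin (N - i) → ℂ) :=
    (LinearMap.funLeft ℂ ℂ fun k : Fin (N - i) => (⟨k + i, by omega⟩ : Fin N)) ∘ₗ Uᴴ.mulVecLin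
  have hL : LinearMap.ker L ≤ bottomSpace U i := fun x hx k hk => by
    have := congrFun (LinearMap.mem_ker.mp hx) ⟨k - i, by omega⟩
    simpa [L, LinearMap.funLeft, Nat.sub_add_cancel hk] using this
  have h1 := L.finrank_range_add_finrank_ker
  have h2 := Submodule.finrank_le (LinearMap.range L)
  have h3 := Submodule.finrank_mono hL
  simp only [Module.finrank_fin_fun] at h1 h2
  omega

lemma quadForm_le_of_mem_bottomSpace {N : ℕ} {H U : Matrix (Fin N) (Fin N) ℂ}
    (hH : H.IsHermitian) (h : IsSortedDiag H U) {i : ℕ} (hi : i < N) {x : Fin N → ℂ}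
    (hx : x ∈ bottomSpace U (i + 1)) : quadForm H x ≤ eig H (i + 1) * sqNorm x := by
  rw [h.quadForm_eq, h.sqNorm_eq, Finset.mul_sum]
  refine Finset.sum_le_sum fun k _ => ?_
  by_cases hk : i + 1 ≤ (k : ℕ)
  · simp [hx k hk]
  · exact mul_le_mul_of_nonneg_right (eig_mono hH (by omega) hi) (Complex.normSq_nonneg _)

/-- The upper bound half of the Courant–Fischer min-max principle. -/
lemma eig_le_of_forall_quadForm_le {N : ℕ} {H : Matrix (Fin N) (Fin N) ℂ}
    (hH : H.IsHermitian) {i : ℕ} (hi : i < N) (W : Submodule ℂ (Fin N → ℂ))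
    (hW : i < Module.finrank ℂ W) {c : ℝ} (hc : ∀ x ∈ W, quadForm H x ≤ c * sqNorm x) :
    eig H (i + 1) ≤ c := by
  obtain ⟨U, h⟩ := exists_isSortedDiag hH
  let L : W →ₗ[ℂ] (Fin i → ℂ) :=
    (LinearMap.funLeft ℂ ℂ (Fin.castLE hi.le)) ∘ₗ Uᴴ.mulVecLin ∘ₗ W.subtype
  obtain ⟨⟨x, hxW⟩, hxL, hx0⟩ := (Submodule.ne_bot_iff _).mp
    (LinearMap.ker_ne_bot_of_finrank_lt (f := L) (by simpa using hW))
  have hx : x ≠ 0 := fun h0 => hx0 (Subtype.ext h0)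
  have hlow : eig H (i + 1) * sqNorm x ≤ quadForm H x := by
    rw [h.quadForm_eq, h.sqNorm_eq, Finset.mul_sum]
    refine Finset.sum_le_sum fun k _ => ?_
    by_cases hk : i ≤ (k : ℕ)
    · exact mul_le_mul_of_nonneg_right (eig_mono hH hk k.2) (Complex.normSq_nonneg _)
    · have := congrFun (LinearMap.mem_ker.mp hxL) ⟨k, by omega⟩
      have h0 : (Uᴴ *ᵥ x) k = 0 := by simpa [L, LinearMap.funLeft] using this
      simp [h0]
  exact le_of_mul_le_mul_right (hlow.trans (hc x hxW)) (sqNorm_pos hx)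

lemma eig_le_eig_of_quadForm_le {N : ℕ} {H K : Matrix (Fin N) (Fin N) ℂ}
    (hH : H.IsHermitian) (hK : K.IsHermitian) (hHK : ∀ x, quadForm H x ≤ quadForm K x)
    {i : ℕ} (hi : i < N) : eig H (i + 1) ≤ eig K (i + 1) := by
  obtain ⟨U, h⟩ := exists_isSortedDiag hK
  exact eig_le_of_forall_quadForm_le hH hi _ (le_finrank_bottomSpace U hi)
    fun x hx => (hHK x).trans (quadForm_le_of_mem_bottomSpace hK h hi hx)

lemma trace_eq_rank_of_isIdempotentElem {N : ℕ} {P : Matrix (Fin N) (Fin N) ℂ}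
    (hP : P * P = P) : P.trace = P.rank := by
  have h := (LinearMap.isProj_range_iff_isIdempotentElem P.mulVecLin).mpr
    (by rw [IsIdempotentElem, Module.End.mul_eq_comp, ← mulVecLin_mul, hP])
  have := h.trace
  rwa [← toLin'_apply', trace_toLin'_eq] at this

lemma IsBottomEigenproj.eq_spectral {N n : ℕ} {H U P : Matrix (Fin N) (Fin N) ℂ}
    (hnN : n < N) (hH : H.IsHermitian) (h : IsSortedDiag H U)
    (hgap : eig H n < eig H (n + 1)) (hP : IsBottomEigenproj n H P) :
    P = U * diagonal (fun k : Fin N => if (k : ℕ) < n then (1 : ℂ) else 0) * Uᴴ := by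
  obtain ⟨⟨hPh, hPP, hPr⟩, hcomm, hle⟩ := hP
  have hker : ∀ k : Fin N, n ≤ (k : ℕ) → P *ᵥ (U *ᵥ Pi.single k 1) = 0 := by
    intro k hk
    by_contra hne
    set v := P *ᵥ (U *ᵥ Pi.single k 1) with hv
    have hHU : H * U = U * diagonal (fun k : Fin N => (eig H (k + 1) : ℂ)) := by
      conv_lhs => rw [h.eq, Matrix.mul_assoc, h.left, Matrix.mul_one]
    have hHv : H *ᵥ v = (eig H (k + 1) : ℂ) • v := by
      rw [hv, mulVec_mulVec, hcomm, ← mulVec_mulVec, mulVec_mulVec _ H, hHU, ← mulVec_mulVec,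
        diagonal_mulVec_single, ← mulVec_smul, ← mulVec_smul]
      simp [← Pi.single_smul]
    have h1 := hle v ⟨_, hv⟩
    rw [hHv, dotProduct_smul, smul_eq_mul, Complex.re_ofReal_mul] at h1
    have h2 := le_of_mul_le_mul_right h1 (sqNorm_pos hne)
    exact absurd (hgap.trans_le (eig_mono hH hk k.2)) (not_lt.mpr h2)
  set D : Matrix (Fin N) (Fin N) ℂ :=
    diagonal (fun k : Fin N => if (k : ℕ) < n then (1 : ℂ) else 0) with hD
  have hDh : Dᴴ = D := by
    rw [hD, diagonal_conjTranspose]; congr 1; ext k; simp [apply_ite]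
  have hDD : D * D = D := by rw [hD, diagonal_mul_diagonal]; simp
  have hPUD : P * U * D = P * U := by
    ext j k
    rw [hD, mul_diagonal]
    split_ifs with hk
    · simp
    · have := congrFun (hker k (by omega)) j
      rw [mulVec_mulVec, mulVec_single_one] at this
      simpa using this.symm
  set Q := U * D * Uᴴ with hQ
  have hQh : Qᴴ = Q := by
    simp [hQ, conjTranspose_mul, hDh, Matrix.mul_assoc]
  have hPQ : P * Q = P := by
    rw [hQ, ← Matrix.mul_assoc, ← Matrix.mul_assoc, hPUD, Matrix.mul_assoc, h.right, Matrix.mul_one]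
  have hQP : Q * P = P := by
    have := congrArg conjTranspose hPQ
    rwa [conjTranspose_mul, hQh, hPh.eq] at this
  have hQQ : Q * Q = Q := by
    calc Q * Q = U * (D * (Uᴴ * U) * D) * Uᴴ := by simp only [hQ, Matrix.mul_assoc]
      _ = Q := by rw [h.left, Matrix.mul_one, hDD]
  have htr : Q.trace = n := by
    rw [hQ, trace_mul_comm, ← Matrix.mul_assoc, h.left, Matrix.one_mul, hD, trace_diagonal,
      Finset.sum_ite]
    simp [Fin.card_filter_val_lt, hnN.le]
  have h0 : (Q - P)ᴴ * (Q - P) = Q - P := by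
    rw [conjTranspose_sub, hQh, hPh.eq, Matrix.sub_mul, Matrix.mul_sub, Matrix.mul_sub, hQQ, hQP,
      hPQ, hPP]
    simp
  have h1 : Q - P = 0 := by
    rw [← trace_conjTranspose_mul_self_eq_zero_iff, h0, trace_sub, htr,
      trace_eq_rank_of_isIdempotentElem hPP, hPr, sub_self]
  exact (sub_eq_zero.mp h1).symm

section Compression

variable {N : ℕ} {B P : Matrix (Fin N) (Fin N) ℂ}

lemma isUnit_compression (hB : (-B).PosDef) (hPh : P.IsHermitian) (hPP : P * P = P) :
    IsUnit (P * B * P + (1 - P)) := by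
  rw [← mulVec_injective_iff_isUnit]
  refine (injective_iff_map_eq_zero (P * B * P + (1 - P)).mulVecLin).mpr fun x hx => ?_
  replace hx : (P * B * P + (1 - P)) *ᵥ x = 0 := hx
  have h1 : P *ᵥ x = x := by
    have : (1 - P) * (P * B * P + (1 - P)) = 1 - P := by
      simp only [Matrix.mul_add, Matrix.sub_mul, Matrix.mul_sub, ← Matrix.mul_assoc, hPP,
        Matrix.one_mul, Matrix.mul_one]
      abel
    have h := congrArg (fun y => (1 - P) *ᵥ y) hx
    simp only [mulVec_mulVec, this, mulVec_zero, sub_mulVec, one_mulVec] at h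
    exact (sub_eq_zero.mp h).symm
  have h2 : star x ⬝ᵥ B *ᵥ x = 0 := by
    have h3 : P *ᵥ (B *ᵥ x) = 0 := by
      rwa [add_mulVec, sub_mulVec, one_mulVec, h1, sub_self, add_zero, ← mulVec_mulVec, h1,
        ← mulVec_mulVec] at hx
    have h4 : star x = star x ᵥ* P := by
      conv_lhs => rw [← h1, star_mulVec, hPh.eq]
    rw [h4, ← dotProduct_mulVec, h3, dotProduct_zero]
  by_contra hne
  have := hB.dotProduct_mulVec_pos hne
  rw [neg_mulVec, dotProduct_neg, h2, neg_zero] at this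
  exact lt_irrefl _ this

/-- The compression factors through the pseudo-inverse `S` of `PBP`. -/
lemma exists_acomp_eq (hB : (-B).PosDef) (hPh : P.IsHermitian) (hPP : P * P = P) :
    ∃ S : Matrix (Fin N) (Fin N) ℂ,
      S.IsHermitian ∧ acomp B P = B * S * B ∧ S * B * S = S ∧ S * B * P = P := by
  have hBh : Bᴴ = B := by simpa using hB.isHermitian.eq
  set M := P * B * P + (1 - P) with hM
  have hu : IsUnit M.det := (isUnit_iff_isUnit_det _).mp (isUnit_compression hB hPh hPP)
  have hl : M⁻¹ * M = 1 := nonsing_inv_mul _ hu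
  have hr : M * M⁻¹ = 1 := mul_nonsing_inv _ hu
  have hPM : P * B * P = M - (1 - P) := by rw [hM]; abel
  have e1 : M * (1 - P) = 1 - P := by
    simp only [hM, Matrix.add_mul, Matrix.sub_mul, Matrix.mul_sub, Matrix.mul_assoc, hPP,
      Matrix.one_mul, Matrix.mul_one]
    abel
  have e2 : (1 - P) * M = 1 - P := by
    simp only [hM, Matrix.mul_add, Matrix.sub_mul, Matrix.mul_sub, ← Matrix.mul_assoc, hPP,
      Matrix.one_mul, Matrix.mul_one]
    abel
  have f1 : M⁻¹ * (1 - P) = 1 - P := by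
    rw [← e1, ← Matrix.mul_assoc, hl, Matrix.one_mul, e1]
  have f2 : (1 - P) * M⁻¹ = 1 - P := by
    rw [← e2, Matrix.mul_assoc, hr, Matrix.mul_one, e2]
  have s1 : M⁻¹ - (1 - P) = M⁻¹ * P := by
    rw [← f1, Matrix.mul_sub, Matrix.mul_one]; abel
  have s2 : M⁻¹ - (1 - P) = P * M⁻¹ := by
    rw [← f2, Matrix.sub_mul, Matrix.one_mul]; abel
  have hMh : M.IsHermitian := by
    rw [IsHermitian, hM]
    simp [conjTranspose_mul, hPh.eq, hBh, Matrix.mul_assoc]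
  have h3 : (M⁻¹ - (1 - P)) * B * P = P := by
    rw [s1, Matrix.mul_assoc, Matrix.mul_assoc, ← Matrix.mul_assoc P, hPM, Matrix.mul_sub, hl, f1]
    abel
  refine ⟨M⁻¹ - (1 - P), hMh.inv.sub (isHermitian_one.sub hPh), ?_, ?_, h3⟩
  · rw [acomp, ← hM, Matrix.mul_sub B M⁻¹, Matrix.sub_mul]
  · conv_lhs => rw [s2, ← Matrix.mul_assoc, ← s2, h3]
    exact s2.symm

lemma isHermitian_acomp (hB : (-B).PosDef) (hPh : P.IsHermitian) (hPP : P * P = P) :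
    (acomp B P).IsHermitian := by
  have hBh : Bᴴ = B := by simpa using hB.isHermitian.eq
  obtain ⟨S, hS, h, -, -⟩ := exists_acomp_eq hB hPh hPP
  rw [h, IsHermitian]
  simp [conjTranspose_mul, hS.eq, hBh, Matrix.mul_assoc]

lemma acomp_mul_self (hB : (-B).PosDef) (hPh : P.IsHermitian) (hPP : P * P = P) :
    acomp B P * P = B * P := by
  obtain ⟨S, -, h, -, h3⟩ := exists_acomp_eq hB hPh hPP
  rw [h, Matrix.mul_assoc, Matrix.mul_assoc, ← Matrix.mul_assoc S, h3]

lemma posSemidef_acomp_sub (hB : (-B).PosDef) (hPh : P.IsHermitian) (hPP : P * P = P) :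
    (acomp B P - B).PosSemidef := by
  have hBh : Bᴴ = B := by simpa using hB.isHermitian.eq
  obtain ⟨S, hS, h, hSBS, -⟩ := exists_acomp_eq hB hPh hPP
  have key : acomp B P - B = (1 - S * B)ᴴ * (-B) * (1 - S * B) := by
    have h4 : B * (S * (B * (S * B))) = B * (S * B) := by
      calc B * (S * (B * (S * B))) = B * (S * B * S * B) := by simp only [Matrix.mul_assoc]
        _ = B * (S * B) := by rw [hSBS]
    simp only [h, conjTranspose_sub, conjTranspose_one, conjTranspose_mul, hS.eq, hBh,
      Matrix.mul_sub, Matrix.sub_mul, Matrix.mul_neg, Matrix.neg_mul, Matrix.one_mul,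
      Matrix.mul_one, Matrix.mul_assoc, h4]
    abel
  rw [key]
  exact hB.posSemidef.conjTranspose_mul_mul_same _

end Compression

/-- **Consistency (Lemma `orderzero`).** Let `P` be the bottom-`n` eigenprojector of
`A + B` (unique thanks to the spectral gap `λ_n < λ_{n+1}`). Then
`λ_i{A + B̃[P]} ≥ λ_i{A+B}` for all `i`, with equality for `i ≤ n`, and `P` is the
unique bottom-`n` eigenprojector of `A + B̃[P]`. -/
theorem acomp_consistency {N n : ℕ} (hn1 : 1 ≤ n) (hnN : n < N)
    (A B : Matrix (Fin N) (Fin N) ℂ) (hA : A.IsHermitian) (hB : (-B).PosDef)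
    (hgap : eig (A + B) n < eig (A + B) (n + 1))
    (P : Matrix (Fin N) (Fin N) ℂ) (hP : IsBottomEigenproj n (A + B) P) :
    (∀ i : ℕ, 1 ≤ i → i ≤ N → eig (A + B) i ≤ eig (A + acomp B P) i) ∧
    (∀ i : ℕ, 1 ≤ i → i ≤ n → eig (A + acomp B P) i = eig (A + B) i) ∧
    IsBottomEigenproj n (A + acomp B P) P ∧
    (∀ R : Matrix (Fin N) (Fin N) ℂ, IsBottomEigenproj n (A + acomp B P) R → R = P) := by
  obtain ⟨⟨hPh, hPP, hPr⟩, hcomm, hle⟩ := id hP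
  have hBh : B.IsHermitian := by simpa using hB.isHermitian.neg
  have hH : (A + B).IsHermitian := hA.add hBh
  have hK : (A + acomp B P).IsHermitian := hA.add (isHermitian_acomp hB hPh hPP)
  have hKP : (A + acomp B P) * P = (A + B) * P := by
    rw [Matrix.add_mul, Matrix.add_mul, acomp_mul_self hB hPh hPP]
  have hKcomm : (A + acomp B P) * P = P * (A + acomp B P) := by
    have h := congrArg conjTranspose hKP
    rw [conjTranspose_mul, conjTranspose_mul, hK.eq, hH.eq, hPh.eq] at h
    rw [h, hKP, hcomm]
  have hquad : ∀ x, quadForm (A + B) x ≤ quadForm (A + acomp B P) x := fun x => by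
    have h := (Complex.le_def.mp
      ((posSemidef_acomp_sub hB hPh hPP).dotProduct_mulVec_nonneg x)).1
    simp only [quadForm, add_mulVec, sub_mulVec, dotProduct_add, dotProduct_sub, Complex.add_re,
      Complex.sub_re, Complex.zero_re] at h ⊢
    linarith
  have hmulVec : ∀ x, P *ᵥ x = x → (A + acomp B P) *ᵥ x = (A + B) *ᵥ x := fun x hx => by
    rw [← hx, mulVec_mulVec, mulVec_mulVec, hKP]
  have hmono : ∀ i : ℕ, 1 ≤ i → i ≤ N → eig (A + B) i ≤ eig (A + acomp B P) i := by
    rintro (_ | i) h1 h2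
    · omega
    · exact eig_le_eig_of_quadForm_le hH hK hquad h2
  obtain ⟨U, hU⟩ := exists_isSortedDiag hH
  have hPU := hP.eq_spectral hnN hH hU hgap
  have hfix : ∀ i ≤ n, ∀ x ∈ bottomSpace U i, P *ᵥ x = x := fun i hi x hx => by
    have hD : diagonal (fun k : Fin N => if (k : ℕ) < n then (1 : ℂ) else 0) *ᵥ (Uᴴ *ᵥ x) =
        Uᴴ *ᵥ x := by
      ext k
      rw [mulVec_diagonal]
      split_ifs with hk
      · rw [one_mul]
      · rw [hx k (by omega), mul_zero]
    rw [hPU, ← mulVec_mulVec, ← mulVec_mulVec, hD, mulVec_mulVec, hU.right, one_mulVec]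
  have heq : ∀ i : ℕ, 1 ≤ i → i ≤ n → eig (A + acomp B P) i = eig (A + B) i := by
    rintro (_ | i) h1 h2
    · omega
    · refine le_antisymm ?_ (hmono _ h1 (by omega))
      refine eig_le_of_forall_quadForm_le hK (by omega) _
        (le_finrank_bottomSpace U (by omega : i + 1 ≤ N)) fun x hx => ?_
      rw [quadForm, hmulVec x (hfix _ h2 x hx)]
      exact quadForm_le_of_mem_bottomSpace hH hU (by omega) hx
  have hPK : IsBottomEigenproj n (A + acomp B P) P := by
    refine ⟨⟨hPh, hPP, hPr⟩, hKcomm, ?_⟩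
    rintro x ⟨y, rfl⟩
    rw [hmulVec _ (by rw [mulVec_mulVec, hPP]), heq n hn1 le_rfl]
    exact hle _ ⟨y, rfl⟩
  refine ⟨hmono, heq, hPK, fun R hR => ?_⟩
  have hgap' : eig (A + acomp B P) n < eig (A + acomp B P) (n + 1) := by
    rw [heq n hn1 le_rfl]
    exact hgap.trans_le (hmono _ (by omega) hnN)
  obtain ⟨V, hV⟩ := exists_isSortedDiag hK
  rw [hR.eq_spectral hnN hK hV hgap', ← hPK.eq_spectral hnN hK hV hgap']
end

section
/- Let A and B be N×N Hermitian complex matrices with B negative definite, and let 1 ≤ n ≤ N. Then for every rank-n orthogonal projector Q on ℂ^N and every i = 1,…,n, λ_i{A+B} ≤ λ_i{A+B̃[Q]} (global eigenvalue minimality: the bottom n eigenvalues of the adaptively compressed operator are minimized, over all rank-n projectors Q, by the values λ_1{A+B},…,λ_n{A+B}). -/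
open Matrix
open scoped ComplexOrder

/-- The quadratic form of a Hermitian matrix in coordinates along its eigenvectors. -/
lemma Matrix.IsHermitian.re_dotProduct_mulVec_eq_sum {N : ℕ} {X : Matrix (Fin N) (Fin N) ℂ}
    (hX : X.IsHermitian) (x : Fin N → ℂ) :
    (star x ⬝ᵥ X *ᵥ x).re = ∑ j, hX.eigenvalues j *
      ‖((hX.eigenvectorUnitary : Matrix (Fin N) (Fin N) ℂ)ᴴ *ᵥ x) j‖ ^ 2 := by
  set U := (hX.eigenvectorUnitary : Matrix (Fin N) (Fin N) ℂ)
  have hXU : X = U * diagonal (fun j => (hX.eigenvalues j : ℂ)) * Uᴴ := by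
    have h := hX.spectral_theorem
    rw [Unitary.conjStarAlgAut_apply] at h
    exact h
  have h : star x ⬝ᵥ X *ᵥ x =
      star (Uᴴ *ᵥ x) ⬝ᵥ (diagonal (fun j => (hX.eigenvalues j : ℂ)) *ᵥ (Uᴴ *ᵥ x)) := by
    rw [star_mulVec, conjTranspose_conjTranspose, ← dotProduct_mulVec]
    conv_lhs => rw [hXU]
    simp only [mulVec_mulVec, Matrix.mul_assoc]
  rw [h, dotProduct, Complex.re_sum]
  refine Finset.sum_congr rfl fun j _ => ?_
  rw [mulVec_diagonal, Pi.star_apply, mul_left_comm, Complex.star_def, Complex.conj_mul',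
    ← Complex.ofReal_pow, ← Complex.ofReal_mul, Complex.ofReal_re]

/-- The coordinates along the eigenvectors of a Hermitian matrix preserve the norm. -/
lemma Matrix.IsHermitian.re_dotProduct_self_eq_sum {N : ℕ} {X : Matrix (Fin N) (Fin N) ℂ}
    (hX : X.IsHermitian) (x : Fin N → ℂ) :
    (star x ⬝ᵥ x).re = ∑ j,
      ‖((hX.eigenvectorUnitary : Matrix (Fin N) (Fin N) ℂ)ᴴ *ᵥ x) j‖ ^ 2 := by
  set U := (hX.eigenvectorUnitary : Matrix (Fin N) (Fin N) ℂ)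
  have hUU : U * Uᴴ = 1 := Unitary.mul_star_self_of_mem hX.eigenvectorUnitary.2
  have h : star x ⬝ᵥ x = star (Uᴴ *ᵥ x) ⬝ᵥ (Uᴴ *ᵥ x) := by
    rw [star_mulVec, conjTranspose_conjTranspose, ← dotProduct_mulVec, mulVec_mulVec, hUU,
      one_mulVec]
  rw [h, dotProduct, Complex.re_sum]
  refine Finset.sum_congr rfl fun j _ => ?_
  rw [Pi.star_apply, Complex.star_def, Complex.conj_mul', ← Complex.ofReal_pow,
    Complex.ofReal_re]

/-- Given two families of linear functionals indexed by `Fin N` on `ℂ^N`, some nonzero vector is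
annihilated by the first family below `k` and by the second family above `k`. -/
lemma exists_ne_zero_mulVec_eq_zero {N : ℕ} (P R : Matrix (Fin N) (Fin N) ℂ)
    (σ τ : Equiv.Perm (Fin N)) (k : Fin N) :
    ∃ x : Fin N → ℂ, x ≠ 0 ∧ (∀ j < k, (P *ᵥ x) (σ j) = 0) ∧ ∀ j > k, (R *ᵥ x) (τ j) = 0 := by
  let M : Matrix (Fin N) (Fin N) ℂ :=
    fun j => if j < k then P (σ j) else if k < j then R (τ j) else 0
  have hdet : M.det = 0 := det_eq_zero_of_row_eq_zero k fun j => by simp [M]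
  obtain ⟨x, hx, hMx⟩ := exists_mulVec_eq_zero_iff.mpr hdet
  refine ⟨x, hx, fun j hj => ?_, fun j hj => ?_⟩
  · simpa [M, mulVec, hj] using congrFun hMx j
  · simpa [M, mulVec, hj, not_lt_of_gt hj] using congrFun hMx j

/-- Weyl monotonicity: the ordered eigenvalues are monotone for the Loewner order. -/
lemma eig_le_eig_of_posSemidef_sub {N : ℕ} {X Y : Matrix (Fin N) (Fin N) ℂ}
    (hX : X.IsHermitian) (hY : Y.IsHermitian) (h : (Y - X).PosSemidef) (i : ℕ) :
    eig X i ≤ eig Y i := by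
  unfold eig
  rw [dif_pos hX, dif_pos hY]
  split_ifs with hi
  swap
  · exact le_rfl
  set k : Fin N := ⟨i - 1, hi⟩
  set σ := Tuple.sort hX.eigenvalues
  set τ := Tuple.sort hY.eigenvalues
  have hσ : Monotone (hX.eigenvalues ∘ σ) := Tuple.monotone_sort _
  have hτ : Monotone (hY.eigenvalues ∘ τ) := Tuple.monotone_sort _
  obtain ⟨x, hx, hxσ, hxτ⟩ := exists_ne_zero_mulVec_eq_zero
    (hX.eigenvectorUnitary : Matrix (Fin N) (Fin N) ℂ)ᴴ
    (hY.eigenvectorUnitary : Matrix (Fin N) (Fin N) ℂ)ᴴ σ τ k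
  have hpos : 0 < (star x ⬝ᵥ x).re :=
    (Complex.pos_iff.mp (dotProduct_star_self_pos_iff.mpr hx)).1
  have hXY : (star x ⬝ᵥ X *ᵥ x).re ≤ (star x ⬝ᵥ Y *ᵥ x).re := by
    have := (Complex.nonneg_iff.mp (h.dotProduct_mulVec_nonneg x)).1
    rw [sub_mulVec, dotProduct_sub, Complex.sub_re] at this
    linarith
  have hlow : hX.eigenvalues (σ k) * (star x ⬝ᵥ x).re ≤ (star x ⬝ᵥ X *ᵥ x).re := by
    rw [hX.re_dotProduct_mulVec_eq_sum, hX.re_dotProduct_self_eq_sum, Finset.mul_sum]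
    refine Finset.sum_le_sum fun l _ => ?_
    obtain ⟨j, rfl⟩ := σ.surjective l
    rcases lt_or_ge j k with hj | hj
    · simp [hxσ j hj]
    · exact mul_le_mul_of_nonneg_right (hσ hj) (by positivity)
  have hupp : (star x ⬝ᵥ Y *ᵥ x).re ≤ hY.eigenvalues (τ k) * (star x ⬝ᵥ x).re := by
    rw [hY.re_dotProduct_mulVec_eq_sum, hY.re_dotProduct_self_eq_sum, Finset.mul_sum]
    refine Finset.sum_le_sum fun l _ => ?_
    obtain ⟨j, rfl⟩ := τ.surjective l
    rcases lt_or_ge k j with hj | hj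
    · simp [hxτ j hj]
    · exact mul_le_mul_of_nonneg_right (hτ hj) (by positivity)
  exact le_of_mul_le_mul_right (hlow.trans (hXY.trans hupp)) hpos

/-- `QBQ + (I - Q)` is invertible when `B` is negative definite and `Q` is a projector. -/
lemma isUnit_det_compression {N : ℕ} {B Q : Matrix (Fin N) (Fin N) ℂ} (hB : (-B).PosDef)
    (hQ : Q.IsHermitian) (hQQ : Q * Q = Q) : IsUnit (Q * B * Q + (1 - Q)).det := by
  rw [isUnit_iff_ne_zero]
  intro hdet
  obtain ⟨v, hv, hMv⟩ := exists_mulVec_eq_zero_iff.mpr hdet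
  have h1 : (1 - Q) * (Q * B * Q + (1 - Q)) = 1 - Q := by
    linear_combination (norm := noncomm_ring) hQQ - hQQ * B * Q
  have hQv : Q *ᵥ v = v := by
    have := congrArg ((1 - Q) *ᵥ ·) hMv
    simp only [mulVec_mulVec, h1, mulVec_zero, sub_mulVec, one_mulVec] at this
    exact (sub_eq_zero.mp this).symm
  have hvB : star v ⬝ᵥ (B *ᵥ v) = 0 := by
    have := congrArg (star v ⬝ᵥ ·) hMv
    simp only [add_mulVec, sub_mulVec, one_mulVec, hQv, sub_self, add_zero, dotProduct_zero,
      ← mulVec_mulVec] at this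
    rwa [dotProduct_mulVec, ← hQ.eq, ← star_mulVec, hQv] at this
  have := hB.dotProduct_mulVec_pos hv
  rw [neg_mulVec, dotProduct_neg, hvB, neg_zero] at this
  exact lt_irrefl _ this

/-- The adaptive compression is `B K B` with `K` Hermitian and `K B K = K`. -/
lemma exists_acomp_eq_s7 {N : ℕ} {B Q : Matrix (Fin N) (Fin N) ℂ} (hB : (-B).PosDef)
    (hQ : Q.IsHermitian) (hQQ : Q * Q = Q) :
    ∃ K : Matrix (Fin N) (Fin N) ℂ, K.IsHermitian ∧ K * B * K = K ∧ acomp B Q = B * K * B := by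
  have hBh : B.IsHermitian := by simpa using hB.isHermitian.neg
  have hM := isUnit_det_compression hB hQ hQQ
  unfold acomp
  set M := Q * B * Q + (1 - Q) with hMdef
  have hQM : Q * M = Q * B * Q := by
    rw [hMdef]
    linear_combination (norm := noncomm_ring) hQQ * B * Q - hQQ
  have hMQ : M * Q = Q * B * Q := by
    rw [hMdef]
    linear_combination (norm := noncomm_ring) Q * B * hQQ - hQQ
  have hMh : M.IsHermitian := by
    refine IsHermitian.add ?_ (isHermitian_one.sub hQ)
    simpa [hQ.eq] using isHermitian_mul_mul_conjTranspose Q hBh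
  have hGM : M⁻¹ * M = 1 := nonsing_inv_mul M hM
  have hMG : M * M⁻¹ = 1 := mul_nonsing_inv M hM
  have hQG : M⁻¹ * Q = Q * M⁻¹ := by
    linear_combination (norm := noncomm_ring)
      M⁻¹ * hQM * M⁻¹ - M⁻¹ * hMQ * M⁻¹ + hGM * Q * M⁻¹ - M⁻¹ * Q * hMG
  have hQ'G : (1 - Q) * M⁻¹ = 1 - Q := by
    have h1 : (1 - Q) * M = 1 - Q := by
      rw [Matrix.sub_mul, Matrix.one_mul, hQM, hMdef]
      abel
    linear_combination (norm := noncomm_ring) (1 - Q) * hMG - h1 * M⁻¹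
  have hK : M⁻¹ - (1 - Q) = Q * M⁻¹ := by
    linear_combination (norm := noncomm_ring) hQ'G
  refine ⟨M⁻¹ - (1 - Q), hMh.inv.sub (isHermitian_one.sub hQ), ?_, ?_⟩
  · rw [hK]
    calc Q * M⁻¹ * B * (Q * M⁻¹) = M⁻¹ * (Q * B * Q) * M⁻¹ := by
          rw [← hQG]; simp only [Matrix.mul_assoc]; rw [hQG]
      _ = M⁻¹ * M * Q * M⁻¹ := by rw [← hMQ]; simp only [Matrix.mul_assoc]
      _ = Q * M⁻¹ := by rw [hGM, Matrix.one_mul]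
  · rw [Matrix.mul_sub B M⁻¹, Matrix.sub_mul]

/-- The adaptive compression of a negative definite matrix is Hermitian and dominates it. -/
lemma acomp_isHermitian_and_posSemidef_sub {N : ℕ} {B Q : Matrix (Fin N) (Fin N) ℂ}
    (hB : (-B).PosDef) (hQ : Q.IsHermitian) (hQQ : Q * Q = Q) :
    (acomp B Q).IsHermitian ∧ (acomp B Q - B).PosSemidef := by
  have hBh : B.IsHermitian := by simpa using hB.isHermitian.neg
  obtain ⟨K, hK, hKBK, hBKB⟩ := exists_acomp_eq_s7 hB hQ hQQ
  rw [hBKB]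
  constructor
  · simpa [hBh.eq] using isHermitian_mul_mul_conjTranspose B hK
  · have h := hB.posSemidef.conjTranspose_mul_mul_same (1 - K * B)
    rw [conjTranspose_sub, conjTranspose_one, conjTranspose_mul, hK.eq, hBh.eq] at h
    convert h using 1
    linear_combination (norm := noncomm_ring) B * hKBK * B

/-- **Global eigenvalue minimality (Lemma `globalEigenMin`).** For every rank-`n`
orthogonal projector `Q` and every `i = 1, …, n`, `λ_i{A+B} ≤ λ_i{A + B̃[Q]}`. -/
theorem acomp_global_eigenvalue_minimality {N n : ℕ} (hn1 : 1 ≤ n) (hnN : n ≤ N)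
    (A B : Matrix (Fin N) (Fin N) ℂ) (hA : A.IsHermitian) (hB : (-B).PosDef) :
    ∀ Q : Matrix (Fin N) (Fin N) ℂ, IsProjOfRank n Q →
      ∀ i : ℕ, 1 ≤ i → i ≤ n → eig (A + B) i ≤ eig (A + acomp B Q) i := by
  intro Q ⟨hQ, hQQ, _⟩ i _ _
  have hBh : B.IsHermitian := by simpa using hB.isHermitian.neg
  obtain ⟨hC, hCB⟩ := acomp_isHermitian_and_posSemidef_sub hB hQ hQQ
  refine eig_le_eig_of_posSemidef_sub (hA.add hBh) (hA.add hC) ?_ i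
  rwa [add_sub_add_left_eq_sub]
end

section
/- Let B be an N×N Hermitian negative definite complex matrix and 1 ≤ n ≤ N. Then there exists a real constant t > 0, depending only on B and n, such that for all rank-n orthogonal projectors Q and R on ℂ^N: Tr[R(B̃[Q] − B)] ≥ t · Tr[R(I − Q)]. -/
open Matrix
open scoped ComplexOrder

open scoped MatrixOrder in
/-- A positive definite matrix dominates a positive multiple of the identity. -/
theorem Matrix.PosDef.exists_pos_sub_smul_one_posSemidef {ι : Type*} [Fintype ι] [DecidableEq ι]
    [Nonempty ι] {A : Matrix ι ι ℂ} (hA : A.PosDef) :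
    ∃ t : ℝ, 0 < t ∧ (A - t • (1 : Matrix ι ι ℂ)).PosSemidef := by
  obtain ⟨t, ht, h⟩ := (CFC.exists_pos_algebraMap_le_iff hA.isHermitian).2 fun x hx => by
    rw [hA.isHermitian.spectrum_real_eq_range_eigenvalues] at hx
    obtain ⟨i, rfl⟩ := hx
    exact hA.eigenvalues_pos i
  exact ⟨t, ht, by simpa [Matrix.le_iff, Algebra.algebraMap_eq_smul_one] using h⟩

/-- If `P` is positive semidefinite and `R` is an orthogonal projector then `Tr (R P) ≥ 0`. -/
theorem Matrix.PosSemidef.re_trace_proj_mul_nonneg {ι : Type*} [Fintype ι]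
    {P R : Matrix ι ι ℂ} (hP : P.PosSemidef) (hR : R.IsHermitian) (hRR : R * R = R) :
    0 ≤ (R * P).trace.re := by
  have h := (hP.conjTranspose_mul_mul_same R).trace_nonneg
  rw [hR.eq, trace_mul_comm, ← mul_assoc, hRR] at h
  exact (Complex.nonneg_iff.1 h).1

/-- The matrix inverted in the adaptive compression is invertible. -/
theorem isUnit_compression_s8 {ι : Type*} [Fintype ι] [DecidableEq ι] {B Q : Matrix ι ι ℂ}
    (hB : (-B).PosDef) (hQ : Q.IsHermitian) (hQQ : Q * Q = Q) :
    IsUnit (Q * B * Q + (1 - Q)) := by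
  rw [← mulVec_injective_iff_isUnit]
  refine (injective_iff_map_eq_zero (mulVecLin (Q * B * Q + (1 - Q)))).2 fun x hx => ?_
  rw [mulVecLin_apply] at hx
  have hQB : (Q * B * Q) *ᵥ x = 0 := by
    have h := congrArg (Q *ᵥ ·) hx
    simpa [mul_add, mul_sub, ← mul_assoc, hQQ] using h
  have hxQ : x = Q *ᵥ x := by
    rw [add_mulVec, hQB, zero_add, sub_mulVec, one_mulVec] at hx
    exact sub_eq_zero.1 hx
  by_contra hx0
  have hpos := hB.dotProduct_mulVec_pos hx0
  have hzero : star x ⬝ᵥ (B *ᵥ x) = 0 := by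
    calc star x ⬝ᵥ (B *ᵥ x) = star (Q *ᵥ x) ⬝ᵥ (B *ᵥ (Q *ᵥ x)) := by rw [← hxQ]
      _ = star x ⬝ᵥ ((Q * B * Q) *ᵥ x) := by
        rw [star_mulVec, hQ.eq, ← dotProduct_mulVec, mulVec_mulVec, mulVec_mulVec, mul_assoc]
      _ = 0 := by rw [hQB, dotProduct_zero]
  rw [neg_mulVec, dotProduct_neg, hzero, neg_zero] at hpos
  exact lt_irrefl _ hpos

/-- The residual of the adaptive compression is a congruence transform of `-B`, by a matrix
that acts as the identity modulo the range of `Q`. -/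
theorem exists_acomp_sub_eq {N : ℕ} {B Q : Matrix (Fin N) (Fin N) ℂ}
    (hB : (-B).PosDef) (hQ : Q.IsHermitian) (hQQ : Q * Q = Q) :
    ∃ Y : Matrix (Fin N) (Fin N) ℂ,
      acomp B Q - B = Yᴴ * (-B) * Y ∧ (1 - Q) * Y = 1 - Q := by
  have hBh : Bᴴ = B := by simpa using hB.isHermitian.eq
  set C := Q * B * Q + (1 - Q) with hC
  have hdet : IsUnit C.det := (isUnit_iff_isUnit_det C).1 (isUnit_compression_s8 hB hQ hQQ)
  have hCC : C⁻¹ * C = 1 := nonsing_inv_mul C hdet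
  have hCC' : C * C⁻¹ = 1 := mul_nonsing_inv C hdet
  have hCQ : C * Q = Q * B * Q := by
    rw [hC]
    simp only [add_mul, sub_mul, one_mul, mul_assoc, hQQ, sub_self, add_zero]
  have hQC : Q * C = Q * B * Q := by
    rw [hC]
    simp only [mul_add, mul_sub, mul_one, ← mul_assoc, hQQ, sub_self, add_zero]
  have hGQ : C⁻¹ * Q = Q * C⁻¹ := by
    calc C⁻¹ * Q = C⁻¹ * (Q * C) * C⁻¹ := by rw [mul_assoc, mul_assoc, hCC', mul_one]
      _ = C⁻¹ * (C * Q) * C⁻¹ := by rw [hQC, hCQ]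
      _ = Q * C⁻¹ := by rw [← mul_assoc, hCC, one_mul]
  have hGh : (C⁻¹)ᴴ = C⁻¹ := by
    rw [conjTranspose_nonsing_inv]
    congr 1
    simp [hC, hQ.eq, hBh, mul_assoc]
  have hG1 : C⁻¹ * (1 - Q) = 1 - Q := by
    calc C⁻¹ * (1 - Q) = C⁻¹ * (C - C * Q) := by rw [hCQ, hC, add_sub_cancel_left]
      _ = 1 - Q := by rw [mul_sub, ← mul_assoc, hCC, one_mul]
  have hG : C⁻¹ = C⁻¹ * Q + (1 - Q) := by
    rw [← hG1, ← mul_add, add_sub_cancel, mul_one]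
  obtain ⟨K, hK⟩ : ∃ K, K = C⁻¹ * Q := ⟨_, rfl⟩
  rw [← hK] at hG
  have hQK : Q * K = K := by rw [hK, hGQ, ← mul_assoc, hQQ]
  have hKh : Kᴴ = K := by rw [hK, conjTranspose_mul, hGh, hQ.eq, hGQ]
  have hKBK : K * B * K = K := by
    calc K * B * K = C⁻¹ * (Q * B * Q) * C⁻¹ := by
          nth_rw 2 [hK]
          rw [hGQ, hK]
          simp only [mul_assoc]
      _ = K := by rw [← hCQ, ← mul_assoc, hCC, one_mul, hK, hGQ]
  refine ⟨1 - K * B, ?_, ?_⟩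
  · have h : B * (K * (B * (K * B))) = B * (K * B) := by
      rw [← mul_assoc B K B, ← mul_assoc K (B * K) B, ← mul_assoc K B K, hKBK, mul_assoc]
    rw [acomp, ← hC, hG, conjTranspose_sub, conjTranspose_mul, hBh, hKh, conjTranspose_one]
    simp only [mul_add, add_mul, mul_sub, sub_mul, mul_one, one_mul, mul_neg, neg_mul, mul_assoc, h]
    abel
  · rw [mul_sub, mul_one, ← mul_assoc, sub_mul, one_mul, hQK, sub_self, zero_mul, sub_zero]

/-- **Lemma `rotate`.** There is a constant `t > 0`, depending only on `B` and `n`,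
such that `Tr[R(B̃[Q] − B)] ≥ t · Tr[R(I − Q)]` for all rank-`n` orthogonal
projectors `Q` and `R`. -/
theorem acomp_trace_lower_bound {N n : ℕ} (hn1 : 1 ≤ n) (hnN : n ≤ N)
    (B : Matrix (Fin N) (Fin N) ℂ) (hB : (-B).PosDef) :
    ∃ t : ℝ, 0 < t ∧ ∀ Q R : Matrix (Fin N) (Fin N) ℂ,
      IsProjOfRank n Q → IsProjOfRank n R →
      t * (Matrix.trace (R * (1 - Q))).re ≤ (Matrix.trace (R * (acomp B Q - B))).re := by
  have : Nonempty (Fin N) := ⟨⟨0, by omega⟩⟩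
  obtain ⟨t, ht, hA⟩ := hB.exists_pos_sub_smul_one_posSemidef
  refine ⟨t, ht, fun Q R ⟨hQ, hQQ, _⟩ ⟨hR, hRR, _⟩ => ?_⟩
  obtain ⟨Y, hM, hY⟩ := exists_acomp_sub_eq hB hQ hQQ
  have hQP : (1 - Q)ᴴ * (1 - Q) = 1 - Q := by
    rw [conjTranspose_sub, hQ.eq, conjTranspose_one, mul_sub, mul_one, sub_mul, one_mul, hQQ,
      sub_self, sub_zero]
  have hYY : Yᴴ * Y = (Q * Y)ᴴ * (Q * Y) + (1 - Q) := by
    have h : Yᴴ * (1 - Q) * Y = 1 - Q := by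
      calc Yᴴ * (1 - Q) * Y = ((1 - Q) * Y)ᴴ * ((1 - Q) * Y) := by
            rw [conjTranspose_mul, ← mul_assoc, mul_assoc Yᴴ _ (1 - Q), hQP]
        _ = 1 - Q := by rw [hY, hQP]
    rw [conjTranspose_mul, hQ.eq, mul_assoc, ← mul_assoc Q Q, hQQ]
    conv_rhs => arg 2; rw [← h]
    rw [mul_sub, sub_mul, mul_one, mul_assoc Yᴴ Q Y, add_sub_cancel]
  have hP : (acomp B Q - B - t • (1 - Q)).PosSemidef := by
    have h : acomp B Q - B - t • (1 - Q) =
        Yᴴ * (-B - t • 1) * Y + t • ((Q * Y)ᴴ * (Q * Y)) := by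
      rw [hM, mul_sub, sub_mul, Matrix.mul_smul, Matrix.smul_mul, mul_one, hYY, smul_add]
      abel
    rw [h]
    exact (hA.conjTranspose_mul_mul_same Y).add
      ((posSemidef_conjTranspose_mul_self _).smul ht.le)
  have h := hP.re_trace_proj_mul_nonneg hR hRR
  rw [mul_sub, trace_sub, Matrix.mul_smul, trace_smul, Complex.sub_re, Complex.smul_re,
    smul_eq_mul] at h
  linarith
end

section
/- Let A and B be N×N Hermitian complex matrices with B negative definite, and let 1 ≤ n ≤ N. Then there exists a constant C > 0, depending only on A, B and n, such that the following holds: for every ε ≥ 0, every rank-n orthogonal projector Q on ℂ^N, and every bottom-n eigenprojector R of A+B̃[Q] with ‖R − Q‖₂ ≤ ε, there exist n orthonormal vectors u_1,…,u_n, each an eigenvector of A+B, such that ‖Q − Σ_{i=1}^n u_i u_i*‖₂ ≤ C·ε. -/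
open Matrix
open scoped ComplexOrder

open scoped Matrix.Norms.L2Operator

theorem LinearMap.IsSymmetric.exists_orthonormalBasis_eigenvectors_diag
    {E : Type*} [NormedAddCommGroup E] [InnerProductSpace ℂ E] [FiniteDimensional ℂ E]
    {N : ℕ} (hN : Module.finrank ℂ E = N) {T q : E →ₗ[ℂ] E}
    (hT : T.IsSymmetric) (hq : q.IsSymmetric) :
    ∃ (w : OrthonormalBasis (Fin N) ℂ E) (μ : Fin N → Module.End.Eigenvalues T),
      (∀ i, T (w i) = (μ i : ℂ) • w i) ∧
      ∀ i j, i ≠ j → μ i = μ j → inner ℂ (w i) (q (w j)) = 0 := by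
  classical
  let V : Module.End.Eigenvalues T → Submodule ℂ E := fun μ => Module.End.eigenspace T μ
  have hV : DirectSum.IsInternal V := hT.direct_sum_isInternal
  have hV' : OrthogonalFamily ℂ (fun μ => V μ) fun μ => (V μ).subtypeₗᵢ :=
    hT.orthogonalFamily_eigenspaces'
  let c : ∀ μ, V μ →ₗ[ℂ] V μ := fun μ =>
    (V μ).orthogonalProjectionOnto.toLinearMap ∘ₗ q ∘ₗ (V μ).subtype
  have hcin : ∀ μ (x y : V μ), inner ℂ x (c μ y) = inner ℂ (x : E) (q y) := by
    intro μ x y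
    simp [c]
  have hc : ∀ μ, (c μ).IsSymmetric := by
    intro μ x y
    rw [← inner_conj_symm, hcin, hcin, ← hq, inner_conj_symm]
  let v : ∀ μ, OrthonormalBasis (Fin (Module.finrank ℂ (V μ))) ℂ (V μ) :=
    fun μ => (hc μ).eigenvectorBasis rfl
  let b := hV.collectedOrthonormalBasis hV' v
  have hb : ∀ a, b a = (v a.1 a.2 : E) := by
    intro a
    simp [b, DirectSum.IsInternal.collectedOrthonormalBasis]
  let e := Fintype.equivFinOfCardEq ((Module.finrank_eq_card_basis b.toBasis).symm.trans hN)
  refine ⟨b.reindex e, fun i => (e.symm i).1, fun i => ?_, fun i j hij hμ => ?_⟩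
  · rw [b.reindex_apply]
    exact Module.End.mem_eigenspace_iff.1 (hV.collectedOrthonormalBasis_mem hV' v _)
  · rw [b.reindex_apply, b.reindex_apply]
    have hne : e.symm i ≠ e.symm j := fun h => hij (e.symm.injective h)
    replace hμ : (e.symm i).1 = (e.symm j).1 := hμ
    generalize e.symm i = a at *
    generalize e.symm j = a' at *
    obtain ⟨μ, k⟩ := a
    obtain ⟨ν, l⟩ := a'
    obtain rfl : μ = ν := by simpa using hμ
    have hkl : k ≠ l := fun h => hne (by rw [h])
    rw [hb, hb, ← hcin, (hc μ).apply_eigenvectorBasis, inner_smul_right,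
      (v μ).orthonormal.2 hkl, mul_zero]

theorem Matrix.norm_entry_le_l2_opNorm {N : ℕ} (M : Matrix (Fin N) (Fin N) ℂ) (i j : Fin N) :
    ‖M i j‖ ≤ ‖M‖ := by
  have h := M.l2_opNorm_mulVec (EuclideanSpace.single j (1 : ℂ))
  refine le_trans ?_ (h.trans_eq (by simp))
  refine le_trans ?_ (PiLp.norm_apply_le _ i)
  simp

theorem Matrix.l2_opNorm_le_of_entry_le {N : ℕ} {M : Matrix (Fin N) (Fin N) ℂ} {η : ℝ}
    (h : ∀ i j, ‖M i j‖ ≤ η) : ‖M‖ ≤ N * (N * η) := by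
  have hM : M = ∑ i, ∑ j, Matrix.single i j (M i j) := M.matrix_eq_sum_single
  have hs : ∀ i j, ‖Matrix.single i j (M i j)‖ ≤ η := by
    intro i j
    refine le_trans ?_ (h i j)
    rw [Matrix.l2_opNorm_def]
    refine ContinuousLinearMap.opNorm_le_bound _ (norm_nonneg _) fun x => ?_
    have : (Matrix.toEuclideanLin (Matrix.single i j (M i j))) x
        = EuclideanSpace.single i (M i j * x j) := by
      ext k
      simp [Matrix.toLpLin_apply, Matrix.single_mulVec, Function.update_apply]
    simp only [LinearEquiv.trans_apply, LinearMap.coe_toContinuousLinearMap', this]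
    rw [EuclideanSpace.single, PiLp.norm_single, norm_mul]
    gcongr
    exact PiLp.norm_apply_le x j
  rw [hM]
  calc _ ≤ ∑ i, ∑ j, ‖Matrix.single i j (M i j)‖ :=
        (norm_sum_le _ _).trans (Finset.sum_le_sum fun i _ => norm_sum_le _ _)
    _ ≤ ∑ _i : Fin N, ∑ _j : Fin N, η :=
        Finset.sum_le_sum fun i _ => Finset.sum_le_sum fun j _ => hs i j
    _ = _ := by simp

theorem Matrix.l2_opNorm_le_one_of_isHermitian_of_mul_self {N : ℕ}
    {Q : Matrix (Fin N) (Fin N) ℂ} (hQ : Q.IsHermitian) (hQQ : Q * Q = Q) : ‖Q‖ ≤ 1 := by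
  have h := Q.l2_opNorm_conjTranspose_mul_self
  rw [hQ.eq, hQQ] at h
  nlinarith [norm_nonneg Q]

theorem Matrix.IsHermitian.exists_unitary_eigenvectors_entry_bound {N : ℕ}
    {S : Matrix (Fin N) (Fin N) ℂ} (hS : S.IsHermitian) :
    ∃ K : ℝ, 0 ≤ K ∧ ∀ Q : Matrix (Fin N) (Fin N) ℂ, Q.IsHermitian →
      ∃ (W : Matrix (Fin N) (Fin N) ℂ) (d : Fin N → ℂ), Wᴴ * W = 1 ∧
        S * W = W * Matrix.diagonal d ∧
        ∀ i j, i ≠ j → ‖(Wᴴ * Q * W) i j‖ ≤ K * ‖S * Q - Q * S‖ := by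
  have hST := Matrix.isSymmetric_toEuclideanLin_iff.2 hS
  set T := Matrix.toEuclideanLin S with hTdef
  obtain ⟨K, hK⟩ := (Set.finite_range fun p : Module.End.Eigenvalues T × Module.End.Eigenvalues T =>
    ‖(p.1 : ℂ) - p.2‖⁻¹).bddAbove
  refine ⟨max K 0, le_max_right _ _, fun Q hQ => ?_⟩
  obtain ⟨w, μ, hw, h0⟩ := hST.exists_orthonormalBasis_eigenvectors_diag (N := N) (by simp)
    (Matrix.isSymmetric_toEuclideanLin_iff.2 hQ)
  let W : Matrix (Fin N) (Fin N) ℂ := Matrix.of fun i j => w j i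
  have hent : ∀ (M : Matrix (Fin N) (Fin N) ℂ) i j,
      (Wᴴ * M * W) i j = inner ℂ (w i) (Matrix.toEuclideanLin M (w j)) := by
    intro M i j
    rw [Matrix.mul_assoc]
    simp [Matrix.mul_apply, W, PiLp.inner_apply, Matrix.toLpLin_apply, Matrix.mulVec, dotProduct,
      mul_comm]
  have hWW : Wᴴ * W = 1 := by
    ext i j
    have := hent 1 i j
    simpa [orthonormal_iff_ite.1 w.orthonormal, Matrix.one_apply] using this
  have hSW : S * W = W * Matrix.diagonal fun i => (μ i : ℂ) := by
    ext i j
    have := congrArg (fun x : EuclideanSpace ℂ (Fin N) => x i) (hw j)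
    rw [Matrix.mul_diagonal]
    simpa [hTdef, Matrix.mul_apply, W, Matrix.toLpLin_apply, Matrix.mulVec, dotProduct,
      mul_comm] using this
  refine ⟨W, fun i => μ i, hWW, hSW, fun i j hij => ?_⟩
  by_cases hμ : μ i = μ j
  · rw [hent, h0 i j hij hμ, norm_zero]
    positivity
  have hWn : ‖W‖ ≤ 1 := by
    have h := W.l2_opNorm_conjTranspose_mul_self
    rw [hWW] at h
    have h1 : ‖(1 : Matrix (Fin N) (Fin N) ℂ)‖ ≤ 1 :=
      Matrix.l2_opNorm_le_one_of_isHermitian_of_mul_self Matrix.isHermitian_one (one_mul 1)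
    nlinarith [norm_nonneg W]
  have hWS : Wᴴ * S = Matrix.diagonal (star fun i => (μ i : ℂ)) * Wᴴ := by
    have := congrArg Matrix.conjTranspose hSW
    simpa [Matrix.conjTranspose_mul, hS.eq, Matrix.diagonal_conjTranspose] using this
  have hreal : (star fun i => (μ i : ℂ)) = fun i => (μ i : ℂ) :=
    funext fun i => hST.conj_eigenvalue_eq_self (μ i).2
  have hcomm : (Wᴴ * (S * Q - Q * S) * W) i j = ((μ i : ℂ) - μ j) * (Wᴴ * Q * W) i j := by
    have : Wᴴ * (S * Q - Q * S) * W = Matrix.diagonal (fun i => (μ i : ℂ)) * (Wᴴ * Q * W)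
        - (Wᴴ * Q * W) * Matrix.diagonal (fun i => (μ i : ℂ)) := by
      rw [hreal] at hWS
      rw [mul_sub, sub_mul, ← mul_assoc Wᴴ S Q, hWS]
      simp only [mul_assoc, hSW]
    rw [this, Matrix.sub_apply, Matrix.diagonal_mul, Matrix.mul_diagonal]
    ring
  have hbd : ‖(Wᴴ * (S * Q - Q * S) * W) i j‖ ≤ ‖S * Q - Q * S‖ := by
    refine (Matrix.norm_entry_le_l2_opNorm _ i j).trans ?_
    calc _ ≤ ‖Wᴴ‖ * ‖S * Q - Q * S‖ * ‖W‖ :=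
          (norm_mul_le _ _).trans (by gcongr; exact norm_mul_le _ _)
      _ ≤ 1 * ‖S * Q - Q * S‖ * 1 := by
          rw [Matrix.l2_opNorm_conjTranspose]; gcongr
      _ = _ := by ring
  have hne : ‖(μ i : ℂ) - μ j‖ ≠ 0 := by
    rw [norm_ne_zero_iff, sub_ne_zero]
    exact fun h => hμ (Subtype.ext h)
  rw [hcomm, norm_mul] at hbd
  have hk : ‖(μ i : ℂ) - μ j‖⁻¹ ≤ max K 0 :=
    (hK ⟨(μ i, μ j), rfl⟩).trans (le_max_left _ _)
  calc ‖(Wᴴ * Q * W) i j‖ = ‖(μ i : ℂ) - μ j‖⁻¹ * (‖(μ i : ℂ) - μ j‖ * ‖(Wᴴ * Q * W) i j‖) := by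
        field_simp
    _ ≤ max K 0 * ‖S * Q - Q * S‖ := by gcongr

theorem Matrix.IsHermitian.exists_finset_card_eq_entry_bound {N n : ℕ}
    {q : Matrix (Fin N) (Fin N) ℂ} (hq : q.IsHermitian) (hqq : q * q = q) (htr : q.trace = n)
    (hnN : n ≤ N) {η : ℝ} (hη : 0 ≤ η) (hoff : ∀ i j, i ≠ j → ‖q i j‖ ≤ η) :
    ∃ I : Finset (Fin N), I.card = n ∧
      ∀ i j, ‖(q - Matrix.diagonal fun i => if i ∈ I then (1 : ℂ) else 0) i j‖ ≤
        4 * N * N * η := by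
  have hre : ∀ i, q i i = ((q i i).re : ℂ) := fun i => (hq.coe_re_apply_self i).symm
  have hsum : ∀ i, (q i i).re = ∑ j, ‖q i j‖ ^ 2 := by
    intro i
    have h : q i i = ((∑ j, ‖q i j‖ ^ 2 : ℝ) : ℂ) := by
      conv_lhs => rw [← hqq]
      rw [Matrix.mul_apply]
      push_cast
      refine Finset.sum_congr rfl fun j _ => ?_
      rw [← hq.apply j i, ← Complex.mul_conj', starRingEnd_apply]
    rw [h, Complex.ofReal_re]
  set a : Fin N → ℝ := fun i => (q i i).re with ha
  have hnorm : ∀ i, ‖q i i‖ = |a i| := fun i => by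
    conv_lhs => rw [hre i]
    rw [Complex.norm_real, Real.norm_eq_abs]
  have hsplit : ∀ i, a i - a i ^ 2 = ∑ j ∈ Finset.univ.erase i, ‖q i j‖ ^ 2 := by
    intro i
    have h1 : a i = ∑ j, ‖q i j‖ ^ 2 := hsum i
    rw [← Finset.add_sum_erase _ _ (Finset.mem_univ i), hnorm, sq_abs] at h1
    linarith
  have hsplit0 : ∀ i, 0 ≤ a i - a i ^ 2 := fun i => by
    rw [hsplit]; positivity
  have ha0 : ∀ i, 0 ≤ a i := fun i => by nlinarith [hsplit0 i, sq_nonneg (a i)]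
  have ha1 : ∀ i, a i ≤ 1 := fun i => by nlinarith [hsplit0 i, sq_nonneg (a i)]
  have hq1 : ∀ i j, ‖q i j‖ ≤ 1 := by
    intro i j
    have : ‖q i j‖ ^ 2 ≤ a i := by
      rw [ha]
      simp only [hsum]
      exact Finset.single_le_sum (f := fun j => ‖q i j‖ ^ 2) (fun _ _ => by positivity)
        (Finset.mem_univ j)
    nlinarith [ha1 i, norm_nonneg (q i j)]
  have hdefect : ∀ i, a i - a i ^ 2 ≤ N * η := by
    intro i
    rw [hsplit]
    calc _ ≤ ∑ j ∈ Finset.univ.erase i, η := Finset.sum_le_sum fun j hj => by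
            have := hoff i j (Finset.ne_of_mem_erase hj).symm
            nlinarith [hq1 i j, norm_nonneg (q i j)]
      _ ≤ ∑ _j : Fin N, η :=
          Finset.sum_le_sum_of_subset_of_nonneg (Finset.erase_subset _ _) fun _ _ _ => hη
      _ = N * η := by simp
  have hatr : ∑ i, a i = n := by
    have := congrArg Complex.re htr
    simpa [Matrix.trace] using this
  have hdiag : ∀ (I : Finset (Fin N)) i,
      ‖(q - Matrix.diagonal fun i => if i ∈ I then (1 : ℂ) else 0) i i‖ =
        |a i - if i ∈ I then 1 else 0| := by
    intro I i
    rw [Matrix.sub_apply, Matrix.diagonal_apply_eq, hre i, ← Real.norm_eq_abs,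
      ← Complex.norm_real]
    split_ifs <;> simp [ha]
  have hoffdiag : ∀ (I : Finset (Fin N)) i j, i ≠ j →
      ‖(q - Matrix.diagonal fun i => if i ∈ I then (1 : ℂ) else 0) i j‖ ≤ η := by
    intro I i j hij
    rw [Matrix.sub_apply, Matrix.diagonal_apply_ne _ hij, sub_zero]
    exact hoff i j hij
  have hN1 : ∀ _i : Fin N, (1 : ℝ) ≤ N := fun i => by exact_mod_cast i.pos
  by_cases hsmall : 2 * N * N * η < 1
  · let I : Finset (Fin N) := Finset.univ.filter fun i => 1 / 2 < a i
    have hround : ∀ i, |a i - if i ∈ I then 1 else 0| ≤ 2 * N * η := by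
      intro i
      have h0 := ha0 i
      have h1 := ha1 i
      have hd := hdefect i
      by_cases hi : 1 / 2 < a i
      · have : i ∈ I := by simp only [I, Finset.mem_filter, Finset.mem_univ, true_and, hi]
        rw [if_pos this, abs_le]
        constructor <;> nlinarith
      · have : i ∉ I := by
          simp only [I, Finset.mem_filter, Finset.mem_univ, true_and, hi, not_false_iff]
        rw [if_neg this, abs_le]
        constructor <;> nlinarith
    have hcard : I.card = n := by
      have h1 : |(n : ℝ) - I.card| < 1 := by
        have h2 : (n : ℝ) - I.card = ∑ i, (a i - if i ∈ I then 1 else 0) := by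
          rw [Finset.sum_sub_distrib, hatr]
          simp
        rw [h2]
        calc _ ≤ ∑ i, |a i - if i ∈ I then 1 else 0| := Finset.abs_sum_le_sum_abs _ _
          _ ≤ ∑ _i : Fin N, 2 * N * η := Finset.sum_le_sum fun i _ => hround i
          _ = 2 * N * N * η := by simp; ring
          _ < 1 := hsmall
      have h3 : |(n : ℤ) - I.card| < 1 := by exact_mod_cast h1
      rw [Int.abs_lt_one_iff] at h3
      omega
    refine ⟨I, hcard, fun i j => ?_⟩
    have hN := hN1 i
    have hNη : η ≤ N * η := by nlinarith
    have hNNη : N * η ≤ N * (N * η) := by nlinarith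
    by_cases hij : i = j
    · subst hij
      rw [hdiag]
      exact (hround i).trans (by linarith)
    · exact (hoffdiag I i j hij).trans (by linarith)
  · obtain ⟨I, -, hI⟩ := Finset.exists_subset_card_eq (s := (Finset.univ : Finset (Fin N)))
      (n := n) (by simpa using hnN)
    refine ⟨I, hI, fun i j => ?_⟩
    have hN := hN1 i
    have hNη : η ≤ N * η := by nlinarith
    have hNNη : N * η ≤ N * (N * η) := by nlinarith
    by_cases hij : i = j
    · subst hij
      rw [hdiag]
      have : |a i - if i ∈ I then 1 else 0| ≤ 1 := by
        have h0 := ha0 i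
        have h1 := ha1 i
        rw [abs_le]
        split_ifs <;> constructor <;> linarith
      linarith
    · exact (hoffdiag I i j hij).trans (by linarith)

theorem Matrix.trace_eq_rank_of_mul_self {N : ℕ} {Q : Matrix (Fin N) (Fin N) ℂ}
    (hQQ : Q * Q = Q) : Q.trace = Q.rank := by
  have hidem : IsIdempotentElem (Matrix.toLin' Q) := by
    rw [IsIdempotentElem, Module.End.mul_eq_comp, ← Matrix.toLin'_mul, hQQ]
  have h := (LinearMap.IsIdempotentElem.isProj_range _ hidem).trace
  rw [Matrix.trace_toLin'_eq] at h
  exact h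

theorem exists_norm_le_mul_norm_compression_mul {N : ℕ} {B : Matrix (Fin N) (Fin N) ℂ}
    (hB : (-B).PosDef) :
    ∃ M : ℝ, 0 ≤ M ∧ ∀ Q : Matrix (Fin N) (Fin N) ℂ, Q.IsHermitian → Q * Q = Q →
      ∀ Y : Matrix (Fin N) (Fin N) ℂ, ‖Y‖ ≤ M * ‖(Q * B * Q + (1 - Q)) * Y‖ := by
  obtain ⟨G, hG⟩ : ∃ G : Matrix (Fin N) (Fin N) ℂ, -B = Gᴴ * G := by
    open scoped MatrixOrder in
    exact CStarAlgebra.nonneg_iff_eq_star_mul_self.mp hB.posSemidef.nonneg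
  have hGu : IsUnit G.det := by
    have h := (Matrix.isUnit_iff_isUnit_det _).1 hB.isUnit
    rw [hG, Matrix.det_mul] at h
    exact isUnit_of_mul_isUnit_right h
  refine ⟨‖G⁻¹‖ ^ 2 + 1, by positivity, fun Q hQ hQQ Y => ?_⟩
  set Z := (Q * B * Q + (1 - Q)) * Y with hZ
  have hQ1 := Matrix.l2_opNorm_le_one_of_isHermitian_of_mul_self hQ hQQ
  have hP1 : ‖1 - Q‖ ≤ 1 := Matrix.l2_opNorm_le_one_of_isHermitian_of_mul_self
    (Matrix.isHermitian_one.sub hQ) (IsIdempotentElem.one_sub hQQ)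
  have hQZ : Q * Z = Q * B * Q * Y := by
    calc Q * Z = (Q * Q) * B * Q * Y + (Q - Q * Q) * Y := by rw [hZ]; noncomm_ring
      _ = _ := by rw [hQQ, sub_self, zero_mul, add_zero]
  have hPZ : (1 - Q) * Z = (1 - Q) * Y := by
    calc (1 - Q) * Z = (Q - Q * Q) * B * Q * Y + (1 - Q - (Q - Q * Q)) * Y := by
          rw [hZ]; noncomm_ring
      _ = _ := by rw [hQQ, sub_self, sub_zero, zero_mul, zero_mul, zero_mul, zero_add]
  have hsq : (G * (Q * Y))ᴴ * (G * (Q * Y)) = -((Q * Y)ᴴ * Z) := by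
    calc (G * (Q * Y))ᴴ * (G * (Q * Y)) = Yᴴ * Q * (Gᴴ * G) * (Q * Y) := by
          simp only [Matrix.conjTranspose_mul, hQ.eq, Matrix.mul_assoc]
      _ = -(Yᴴ * (Q * B * Q * Y)) := by rw [← hG]; noncomm_ring
      _ = _ := by
          rw [← hQZ, Matrix.conjTranspose_mul, hQ.eq, Matrix.mul_assoc]
  clear_value Z
  have hQY : ‖Q * Y‖ ≤ ‖G⁻¹‖ * ‖G * (Q * Y)‖ := by
    calc ‖Q * Y‖ = ‖G⁻¹ * (G * (Q * Y))‖ := by rw [Matrix.nonsing_inv_mul_cancel_left _ _ hGu]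
      _ ≤ _ := norm_mul_le _ _
  have hGQY : ‖G * (Q * Y)‖ * ‖G * (Q * Y)‖ ≤ ‖Q * Y‖ * ‖Z‖ := by
    rw [← Matrix.l2_opNorm_conjTranspose_mul_self, hsq, norm_neg]
    exact (norm_mul_le _ _).trans_eq (by rw [Matrix.l2_opNorm_conjTranspose])
  have hbound : ‖G * (Q * Y)‖ ≤ ‖G⁻¹‖ * ‖Z‖ := by
    by_contra! hlt
    have hpos : 0 < ‖G * (Q * Y)‖ := lt_of_le_of_lt (by positivity) hlt
    have h1 : ‖Q * Y‖ * ‖Z‖ ≤ ‖G⁻¹‖ * ‖G * (Q * Y)‖ * ‖Z‖ := by gcongr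
    have h2 := mul_lt_mul_of_pos_right hlt hpos
    linarith
  have hPY : ‖(1 - Q) * Y‖ ≤ ‖Z‖ := by
    rw [← hPZ]
    exact (norm_mul_le _ _).trans (mul_le_of_le_one_left (norm_nonneg _) hP1)
  calc ‖Y‖ = ‖Q * Y + (1 - Q) * Y‖ := by congr 1; noncomm_ring
    _ ≤ ‖Q * Y‖ + ‖(1 - Q) * Y‖ := norm_add_le _ _
    _ ≤ ‖G⁻¹‖ * (‖G⁻¹‖ * ‖Z‖) + ‖Z‖ := by
        gcongr
        exact hQY.trans (by gcongr)
    _ = _ := by ring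

theorem acomp_bound_and_mul_proj {N : ℕ} {B : Matrix (Fin N) (Fin N) ℂ} (hB : (-B).PosDef) :
    ∃ M : ℝ, 0 ≤ M ∧ ∀ Q : Matrix (Fin N) (Fin N) ℂ, Q.IsHermitian → Q * Q = Q →
      ‖acomp B Q‖ ≤ M ∧ acomp B Q * Q = B * Q ∧ Q * acomp B Q = Q * B := by
  obtain ⟨M, hM0, hM⟩ := exists_norm_le_mul_norm_compression_mul hB
  refine ⟨‖B‖ * M * ‖B‖ + ‖B‖ * ‖B‖, by positivity, fun Q hQ hQQ => ?_⟩
  have hXu : IsUnit (Q * B * Q + (1 - Q)).det := by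
    rw [isUnit_iff_ne_zero]
    intro hdet
    obtain ⟨v, hv, hv0⟩ := Matrix.exists_mulVec_eq_zero_iff.2 hdet
    have h := hM Q hQ hQQ (Matrix.vecMulVec v (fun _ => 1))
    rw [Matrix.mul_vecMulVec, hv0, Matrix.zero_vecMulVec, norm_zero, mul_zero,
      norm_le_zero_iff] at h
    refine hv (funext fun i => ?_)
    simpa [Matrix.vecMulVec_apply] using congrFun (congrFun h i) i
  have hX := hM Q hQ hQQ (Q * B * Q + (1 - Q))⁻¹
  rw [Matrix.mul_nonsing_inv _ hXu] at hX
  have h1 : ‖(1 : Matrix (Fin N) (Fin N) ℂ)‖ ≤ 1 :=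
    Matrix.l2_opNorm_le_one_of_isHermitian_of_mul_self Matrix.isHermitian_one (one_mul 1)
  have hP1 : ‖1 - Q‖ ≤ 1 := Matrix.l2_opNorm_le_one_of_isHermitian_of_mul_self
    (Matrix.isHermitian_one.sub hQ) (IsIdempotentElem.one_sub hQQ)
  have hXM : ‖(Q * B * Q + (1 - Q))⁻¹‖ ≤ M := hX.trans (mul_le_of_le_one_right hM0 h1)
  unfold acomp
  refine ⟨?_, ?_, ?_⟩
  · refine (norm_sub_le _ _).trans (add_le_add ?_ ?_)
    · calc _ ≤ ‖B‖ * ‖(Q * B * Q + (1 - Q))⁻¹‖ * ‖B‖ :=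
            (norm_mul_le _ _).trans (by gcongr; exact norm_mul_le _ _)
        _ ≤ _ := by gcongr
    · calc _ ≤ ‖B‖ * ‖1 - Q‖ * ‖B‖ :=
            (norm_mul_le _ _).trans (by gcongr; exact norm_mul_le _ _)
        _ ≤ ‖B‖ * 1 * ‖B‖ := by gcongr
        _ = _ := by ring
  · have h : (Q * B * Q + (1 - Q)) * (Q + (1 - Q) * B * Q) = B * Q := by
      calc _ = Q * B * (Q * Q) + Q * B * (Q - Q * Q) * B * Q + (Q - Q * Q)
            + (1 - Q - (Q - Q * Q)) * B * Q := by noncomm_ring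
        _ = B * Q := by rw [hQQ]; noncomm_ring
    have h' : (Q * B * Q + (1 - Q))⁻¹ * (B * Q) = Q + (1 - Q) * B * Q := by
      rw [← h, Matrix.nonsing_inv_mul_cancel_left _ _ hXu]
    rw [sub_mul, mul_assoc, mul_assoc B, h']
    noncomm_ring
  · have h : (Q + Q * B * (1 - Q)) * (Q * B * Q + (1 - Q)) = Q * B := by
      calc _ = (Q * Q) * B * Q + (Q - Q * Q) + Q * B * (Q - Q * Q) * B * Q
            + Q * B * (1 - Q - (Q - Q * Q)) := by noncomm_ring
        _ = Q * B := by rw [hQQ]; noncomm_ring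
    have h' : Q * B * (Q * B * Q + (1 - Q))⁻¹ = Q + Q * B * (1 - Q) := by
      rw [← Matrix.mul_nonsing_inv_cancel_right _ (Q + Q * B * (1 - Q)) hXu, h]
    rw [mul_sub, ← mul_assoc, ← mul_assoc, h']
    noncomm_ring

/-- **Lemma `almostEigen`.** There is a constant `C > 0`, depending only on `A`, `B`
and `n`, such that whenever `Q` is a rank-`n` orthogonal projector and `R` is a
bottom-`n` eigenprojector of `A + B̃[Q]` with `‖R − Q‖₂ ≤ ε`, there exist orthonormal
vectors `u_1, …, u_n`, each an eigenvector of `A + B`, with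
`‖Q − Σ_i u_i u_i*‖₂ ≤ C·ε`. -/
theorem acomp_almost_fixed_near_invariant {N n : ℕ} (hn1 : 1 ≤ n) (hnN : n ≤ N)
    (A B : Matrix (Fin N) (Fin N) ℂ) (hA : A.IsHermitian) (hB : (-B).PosDef) :
    ∃ C : ℝ, 0 < C ∧
      ∀ ε : ℝ, 0 ≤ ε →
        ∀ Q R : Matrix (Fin N) (Fin N) ℂ, IsProjOfRank n Q →
          IsBottomEigenproj n (A + acomp B Q) R →
          specNorm (R - Q) ≤ ε →
          ∃ u : Fin n → (Fin N → ℂ),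
            (∀ i j : Fin n, star (u i) ⬝ᵥ u j = if i = j then 1 else 0) ∧
            (∀ i : Fin n, ∃ μ : ℂ, (A + B).mulVec (u i) = μ • u i) ∧
            specNorm (Q - ∑ i : Fin n, Matrix.vecMulVec (u i) (star (u i))) ≤ C * ε := by
  have hS : (A + B).IsHermitian := by
    have := hB.isHermitian.neg
    rw [neg_neg] at this
    exact hA.add this
  obtain ⟨K, hK0, hK⟩ := hS.exists_unitary_eigenvectors_entry_bound
  obtain ⟨M, hM0, hM⟩ := acomp_bound_and_mul_proj hB
  refine ⟨N * (N * (4 * N * N * (K * (2 * (‖A‖ + M))))) + 1, by positivity,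
    fun ε hε Q R hQ hR hRQ => ?_⟩
  obtain ⟨hQH, hQQ, hQr⟩ := hQ
  obtain ⟨hMQ, hQ1, hQ2⟩ := hM Q hQH hQQ
  replace hRQ : ‖R - Q‖ ≤ ε := hRQ
  set H := A + acomp B Q with hH
  have hHn : ‖H‖ ≤ ‖A‖ + M := (norm_add_le _ _).trans (by gcongr)
  have hcomm : ‖(A + B) * Q - Q * (A + B)‖ ≤ 2 * (‖A‖ + M) * ε := by
    have h : (A + B) * Q - Q * (A + B) = (R - Q) * H - H * (R - Q) := by
      calc _ = (A * Q + B * Q) - (Q * A + Q * B) := by noncomm_ring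
        _ = H * Q - Q * H := by rw [← hQ1, ← hQ2, hH]; noncomm_ring
        _ = _ := by rw [sub_mul, mul_sub, hR.2.1]; abel
    rw [h]
    calc _ ≤ ‖R - Q‖ * ‖H‖ + ‖H‖ * ‖R - Q‖ :=
          (norm_sub_le _ _).trans (add_le_add (norm_mul_le _ _) (norm_mul_le _ _))
      _ ≤ ε * (‖A‖ + M) + (‖A‖ + M) * ε := by gcongr
      _ = _ := by ring
  obtain ⟨W, d, hWW, hSW, hoff⟩ := hK Q hQH
  have hWW' : W * Wᴴ = 1 := mul_eq_one_comm.1 hWW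
  have hq : (Wᴴ * Q * W).IsHermitian := Matrix.isHermitian_conjTranspose_mul_mul W hQH
  have hqq : (Wᴴ * Q * W) * (Wᴴ * Q * W) = Wᴴ * Q * W := by
    calc _ = Wᴴ * Q * (W * Wᴴ) * Q * W := by noncomm_ring
      _ = Wᴴ * (Q * Q) * W := by rw [hWW']; noncomm_ring
      _ = _ := by rw [hQQ]
  have htr : (Wᴴ * Q * W).trace = n := by
    rw [Matrix.trace_mul_comm, ← Matrix.mul_assoc, hWW', Matrix.one_mul,
      Matrix.trace_eq_rank_of_mul_self hQQ, hQr]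
  obtain ⟨I, hI, hbd⟩ := hq.exists_finset_card_eq_entry_bound hqq htr hnN
    (η := K * (2 * (‖A‖ + M) * ε)) (by positivity)
    fun i j hij => (hoff i j hij).trans (by gcongr)
  have hWn : ‖W‖ ≤ 1 := by
    have h := W.l2_opNorm_conjTranspose_mul_self
    rw [hWW] at h
    have h1 : ‖(1 : Matrix (Fin N) (Fin N) ℂ)‖ ≤ 1 :=
      Matrix.l2_opNorm_le_one_of_isHermitian_of_mul_self Matrix.isHermitian_one (one_mul 1)
    nlinarith [norm_nonneg W]
  let f := I.orderEmbOfFin hI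
  refine ⟨fun k i => W i (f k), fun k l => ?_, fun k => ⟨d (f k), ?_⟩, ?_⟩
  · have h : star (fun i => W i (f k)) ⬝ᵥ (fun i => W i (f l)) = (Wᴴ * W) (f k) (f l) := by
      simp [Matrix.mul_apply, dotProduct]
    rw [h, hWW, Matrix.one_apply]
    simp
  · ext i
    have h := congrFun (congrFun hSW i) (f k)
    rw [Matrix.mul_diagonal, mul_comm] at h
    exact h
  · have hP : ∑ k : Fin n, Matrix.vecMulVec (fun i => W i (f k)) (star fun i => W i (f k)) =
        W * (Matrix.diagonal fun i => if i ∈ I then (1 : ℂ) else 0) * Wᴴ := by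
      ext a b
      rw [Matrix.sum_apply, Matrix.mul_apply]
      simp only [Matrix.mul_diagonal, Matrix.vecMulVec_apply, Pi.star_apply,
        Matrix.conjTranspose_apply, mul_ite, mul_one, mul_zero, ite_mul, zero_mul]
      rw [← Finset.sum_filter, Finset.filter_mem_eq_inter, Finset.univ_inter]
      conv_rhs => rw [← Finset.map_orderEmbOfFin_univ I hI, Finset.sum_map]
      rfl
    have hQP : Q - W * (Matrix.diagonal fun i => if i ∈ I then (1 : ℂ) else 0) * Wᴴ =
        W * (Wᴴ * Q * W - Matrix.diagonal fun i => if i ∈ I then (1 : ℂ) else 0) * Wᴴ := by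
      rw [mul_sub, sub_mul]
      congr 1
      calc Q = (W * Wᴴ) * Q * (W * Wᴴ) := by rw [hWW', one_mul, mul_one]
        _ = _ := by noncomm_ring
    rw [hP, hQP]
    change ‖_‖ ≤ _
    set D := Wᴴ * Q * W - Matrix.diagonal fun i => if i ∈ I then (1 : ℂ) else 0
    calc ‖W * D * Wᴴ‖ ≤ ‖W‖ * ‖D‖ * ‖Wᴴ‖ :=
          (norm_mul_le _ _).trans (by gcongr; exact norm_mul_le _ _)
      _ ≤ 1 * ‖D‖ * 1 := by rw [Matrix.l2_opNorm_conjTranspose]; gcongr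
      _ ≤ N * (N * (4 * N * N * (K * (2 * (‖A‖ + M) * ε)))) := by
          rw [one_mul, mul_one]
          exact Matrix.l2_opNorm_le_of_entry_le hbd
      _ ≤ _ := by linarith
end

section
/- Let S be an m×m Hermitian negative definite complex matrix and let D be an m×m real diagonal matrix with D ⪰ g·I for some real g > 0. Then I − S⁻¹D is invertible, the matrix J := (I − S⁻¹D)⁻¹ is diagonalizable, every eigenvalue of J is a real number in the open interval (0,1), and every eigenvalue of J is at most ‖S‖₂ / (g + ‖S‖₂). -/
open Matrix
open scoped ComplexOrder

/-- A positive definite matrix and a positive diagonal matrix are simultaneously diagonalizable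
by congruence: the generalized eigenvalue problem `A x = k D x` has a full set of eigenvectors. -/
lemma Matrix.PosDef.exists_mul_eq_diagonal_mul_mul_diagonal {n : Type*} [Fintype n]
    [DecidableEq n] {A : Matrix n n ℂ} (hA : A.PosDef) {d : n → ℝ} (hd : ∀ i, 0 < d i) :
    ∃ (U : Matrix n n ℂ) (k : n → ℝ), IsUnit U ∧ (∀ i, 0 < k i) ∧
      A * U = diagonal (fun i => (d i : ℂ)) * U * diagonal (fun i => (k i : ℂ)) := by
  set E : Matrix n n ℂ := diagonal fun i => (√(d i) : ℂ) with hE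
  set F : Matrix n n ℂ := diagonal fun i => ((√(d i))⁻¹ : ℂ) with hF
  have hs (i : n) : (√(d i) : ℂ) ≠ 0 := by
    exact_mod_cast (Real.sqrt_pos.mpr (hd i)).ne'
  have hEF : E * F = 1 := by
    simp [hE, hF, diagonal_mul_diagonal, hs]
  have hEE : E * E = diagonal fun i => (d i : ℂ) := by
    simp only [hE, diagonal_mul_diagonal]
    congr! 2 with i
    exact_mod_cast Real.mul_self_sqrt (hd i).le
  have hFu : IsUnit F := IsUnit.of_mul_eq_one _ (mul_eq_one_comm.mp hEF)
  have hFH : Fᴴ = F := by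
    rw [hF, diagonal_conjTranspose]
    congr! 2 with i
    simp
  have hK : (F * A * F).PosDef := by
    have := hA.conjTranspose_mul_mul_same (mulVec_injective_of_isUnit hFu)
    rwa [hFH] at this
  set V : Matrix n n ℂ := (hK.isHermitian.eigenvectorUnitary : Matrix n n ℂ)
  have hVV : star V * V = 1 := Unitary.coe_star_mul_self hK.isHermitian.eigenvectorUnitary
  have hVu : IsUnit V := IsUnit.of_mul_eq_one _ (mul_eq_one_comm.mp hVV)
  have hKV : F * A * F * V = V * diagonal fun i => (hK.isHermitian.eigenvalues i : ℂ) := by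
    conv_lhs => rw [hK.isHermitian.spectral_theorem, Unitary.conjStarAlgAut_apply]
    rw [mul_assoc, hVV, mul_one]
    rfl
  refine ⟨F * V, hK.isHermitian.eigenvalues, hFu.mul hVu, hK.eigenvalues_pos, ?_⟩
  calc A * (F * V) = (E * F) * (A * (F * V)) := by rw [hEF, one_mul]
    _ = E * (F * A * F * V) := by simp only [mul_assoc]
    _ = E * (E * F) * V * diagonal fun i => (hK.isHermitian.eigenvalues i : ℂ) := by
      rw [hKV, hEF, mul_one, ← mul_assoc E V]
    _ = _ := by rw [← hEE]; simp only [mul_assoc]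

/-- A generalized eigenvalue `k` of `A x = k D x` with `D ⪰ g I` satisfies `k g ≤ ‖A‖₂`. -/
lemma mul_le_specNorm_of_mulVec_eq {m : ℕ} {A : Matrix (Fin m) (Fin m) ℂ} {d : Fin m → ℝ}
    {g k : ℝ} (hg : 0 ≤ g) (hd : ∀ i, g ≤ d i) (hk : 0 ≤ k) {x : Fin m → ℂ} (hx : x ≠ 0)
    (h : A *ᵥ x = fun i => (k * d i * x i : ℂ)) : k * g ≤ specNorm A := by
  set y : EuclideanSpace ℂ (Fin m) := WithLp.toLp 2 x with hy
  have hy0 : 0 < ‖y‖ := by simpa [hy] using hx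
  have hle : ‖Matrix.toEuclideanLin A y‖ ≤ specNorm A * ‖y‖ :=
    (LinearMap.toContinuousLinearMap (Matrix.toEuclideanLin A)).le_opNorm y
  have hAy : Matrix.toEuclideanLin A y = WithLp.toLp 2 fun i => (k * d i * x i : ℂ) := by
    rw [hy, Matrix.toLpLin_toLp, toLin'_apply, h]
  have hge : ‖((k * g : ℝ) : ℂ) • y‖ ≤ ‖Matrix.toEuclideanLin A y‖ := by
    rw [hAy, EuclideanSpace.norm_eq, EuclideanSpace.norm_eq]
    refine Real.sqrt_le_sqrt (Finset.sum_le_sum fun i _ => ?_)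
    have hdi : 0 ≤ d i := hg.trans (hd i)
    simp only [hy, PiLp.smul_apply, smul_eq_mul, norm_mul, Complex.norm_real, Real.norm_eq_abs,
      abs_of_nonneg hk, abs_of_nonneg hg, abs_of_nonneg hdi]
    gcongr
    exact hd i
  rw [norm_smul, Complex.norm_real, Real.norm_of_nonneg (by positivity)] at hge
  exact le_of_mul_le_mul_right (hge.trans hle) hy0

lemma specNorm_neg {m : ℕ} (A : Matrix (Fin m) (Fin m) ℂ) : specNorm (-A) = specNorm A := by
  simp [specNorm]

/-- **Lemma `eigenJ`.** Let `S` be Hermitian negative definite and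
`D = diagonal d` real diagonal with `D ⪰ g·I` for some `g > 0`. Then `I − S⁻¹D` is
invertible, `J := (I − S⁻¹D)⁻¹` is diagonalizable, every eigenvalue of `J` is a real
number in `(0,1)`, and every eigenvalue is at most `‖S‖₂ / (g + ‖S‖₂)`. -/
theorem eigenJ_spectrum {m : ℕ} (hm : 1 ≤ m)
    (S : Matrix (Fin m) (Fin m) ℂ) (hS : (-S).PosDef)
    (d : Fin m → ℝ) (g : ℝ) (hg : 0 < g) (hd : ∀ i, g ≤ d i) :
    IsUnit (1 - S⁻¹ * Matrix.diagonal (fun i => (d i : ℂ))) ∧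
    (∃ (U : Matrix (Fin m) (Fin m) ℂ) (e : Fin m → ℂ), IsUnit U ∧
      (1 - S⁻¹ * Matrix.diagonal (fun i => (d i : ℂ)))⁻¹ = U * Matrix.diagonal e * U⁻¹) ∧
    (∀ μ ∈ spectrum ℂ ((1 - S⁻¹ * Matrix.diagonal (fun i => (d i : ℂ)))⁻¹),
      μ.im = 0 ∧ 0 < μ.re ∧ μ.re < 1 ∧ μ.re ≤ specNorm S / (g + specNorm S)) := by
  obtain ⟨U, k, hU, hk, hAU⟩ :=
    hS.exists_mul_eq_diagonal_mul_mul_diagonal fun i => hg.trans_le (hd i)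
  set D : Matrix (Fin m) (Fin m) ℂ := diagonal fun i => (d i : ℂ) with hD
  have hUdet : IsUnit U.det := (isUnit_iff_isUnit_det U).mp hU
  have hSdet : IsUnit S.det := by
    rw [← isUnit_iff_isUnit_det, ← IsUnit.neg_iff]
    exact hS.isUnit
  have hk1 (i : Fin m) : (1 + k i : ℂ) ≠ 0 := by
    exact_mod_cast (add_pos one_pos (hk i)).ne'
  have hk0 (i : Fin m) : (k i : ℂ) ≠ 0 := by
    exact_mod_cast (hk i).ne'
  set e : Fin m → ℂ := fun i => k i / (1 + k i) with he
  have hKK : (diagonal fun i => (k i : ℂ)) * (diagonal fun i => (k i : ℂ)⁻¹) = 1 := by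
    simp [diagonal_mul_diagonal, hk0]
  have hDU : S⁻¹ * D * U = -(U * diagonal fun i => (k i : ℂ)⁻¹) := by
    have : D * U = S * -(U * diagonal fun i => (k i : ℂ)⁻¹) := by
      rw [mul_neg, ← neg_mul, ← mul_assoc, hAU, mul_assoc _ (diagonal _), hKK, mul_one]
    rw [mul_assoc, this, nonsing_inv_mul_cancel_left _ _ hSdet]
  have hmul : (1 - S⁻¹ * D) * (U * diagonal e * U⁻¹) = 1 := by
    have hee : diagonal e + (diagonal fun i => (k i : ℂ)⁻¹) * diagonal e = 1 := by
      rw [diagonal_mul_diagonal, diagonal_add, ← diagonal_one]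
      congr! 2 with i
      have := hk0 i
      have := hk1 i
      simp only [he]
      field_simp
      ring
    calc (1 - S⁻¹ * D) * (U * diagonal e * U⁻¹)
        = (U * diagonal e - S⁻¹ * D * U * diagonal e) * U⁻¹ := by noncomm_ring
      _ = U * (diagonal e + (diagonal fun i => (k i : ℂ)⁻¹) * diagonal e) * U⁻¹ := by
        rw [hDU]; noncomm_ring
      _ = 1 := by rw [hee, mul_one, mul_nonsing_inv _ hUdet]
  have hJ : (1 - S⁻¹ * D)⁻¹ = U * diagonal e * U⁻¹ := inv_eq_right_inv hmul
  refine ⟨IsUnit.of_mul_eq_one _ hmul, ⟨U, e, hU, hJ⟩, fun μ hμ => ?_⟩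
  have hspec : spectrum ℂ (U * diagonal e * U⁻¹) = Set.range e := by
    rw [← spectrum_diagonal e, ← hU.unit_spec, ← coe_units_inv, spectrum.units_conjugate]
  rw [hJ, hspec] at hμ
  obtain ⟨i, rfl⟩ := hμ
  have hei : e i = ((k i / (1 + k i) : ℝ) : ℂ) := by simp [he]
  have hki := hk i
  have hcol : U.col i ≠ 0 := by
    intro h0
    have h1 : U *ᵥ Pi.single i 1 = U *ᵥ 0 := by rw [mulVec_single_one, h0, mulVec_zero]
    simpa using congrFun (mulVec_injective_of_isUnit hU h1) i
  have hkg : k i * g ≤ specNorm S := by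
    rw [← specNorm_neg]
    refine mul_le_specNorm_of_mulVec_eq hg.le hd hki.le hcol ?_
    ext j
    have := congrFun (congrFun hAU j) i
    rw [mul_diagonal, hD, diagonal_mul] at this
    change (-S * U) j i = k i * d j * U j i
    rw [this]
    ring
  rw [hei, Complex.ofReal_im, Complex.ofReal_re]
  refine ⟨rfl, by positivity, (div_lt_one (by positivity)).mpr (by linarith), ?_⟩
  have hs : 0 < specNorm S := (mul_pos hki hg).trans_le hkg
  rw [div_le_div_iff₀ (by positivity) (by positivity)]
  linarith
end

section
/- Let T be an m×m Hermitian positive definite complex matrix and let D be an m×m real diagonal matrix all of whose diagonal entries are nonzero, such that T + D is positive definite. Then I + T⁻¹D is invertible, the matrix J := (I + T⁻¹D)⁻¹ is diagonalizable, every eigenvalue of J is a positive real number different from 1, and if D has at least one strictly negative diagonal entry then J has an eigenvalue strictly greater than 1. -/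
open Matrix
open scoped ComplexOrder

open scoped MatrixOrder in
/-- A positive definite matrix and a Hermitian matrix are simultaneously diagonalized by a
congruence that turns the former into the identity. -/
lemma exists_simultaneous_diagonalization {n : Type*} [Fintype n] [DecidableEq n]
    {A T : Matrix n n ℂ} (hA : A.PosDef) (hT : T.IsHermitian) :
    ∃ (U : Matrix n n ℂ) (e : n → ℝ), IsUnit U ∧ star U * A * U = 1 ∧
      star U * T * U = diagonal (fun i => (e i : ℂ)) := by
  obtain ⟨B, rfl⟩ := CStarAlgebra.nonneg_iff_eq_star_mul_self.mp hA.posSemidef.nonneg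
  have hB : IsUnit B := isUnit_of_mul_isUnit_right hA.isUnit
  lift B to (Matrix n n ℂ)ˣ using hB
  set C : Matrix n n ℂ := ↑(B⁻¹)
  have hBC : (B : Matrix n n ℂ) * C = 1 := B.mul_inv
  have hH : (star C * T * C).IsHermitian := isHermitian_conjTranspose_mul_mul C hT
  have hV : star (hH.eigenvectorUnitary : Matrix n n ℂ) * hH.eigenvectorUnitary = 1 :=
    Unitary.coe_star_mul_self _
  have hspec := hH.conjStarAlgAut_star_eigenvectorUnitary
  rw [Unitary.conjStarAlgAut_star_apply] at hspec
  set V : Matrix n n ℂ := (hH.eigenvectorUnitary).1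
  refine ⟨C * V, hH.eigenvalues, (B⁻¹).isUnit.mul (IsUnit.of_mul_eq_one_right _ hV), ?_, ?_⟩
  · calc star (C * V) * (star (B : Matrix n n ℂ) * B) * (C * V)
        = star V * (star ((B : Matrix n n ℂ) * C) * ((B : Matrix n n ℂ) * C)) * V := by
          simp only [star_mul, mul_assoc]
      _ = 1 := by rw [hBC, star_one, mul_one, mul_one, hV]
  · calc star (C * V) * T * (C * V) = star V * (star C * T * C) * V := by
          simp only [star_mul, mul_assoc]
      _ = _ := hspec

/-- **Lemma `eigenJGeneral`.** Let `T` be Hermitian positive definite and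
`D = diagonal d` real diagonal with all diagonal entries nonzero, such that `T + D` is
positive definite. Then `I + T⁻¹D` is invertible, `J := (I + T⁻¹D)⁻¹` is diagonalizable,
every eigenvalue of `J` is a positive real number different from `1`, and if some
diagonal entry of `D` is strictly negative then `J` has an eigenvalue strictly greater
than `1`. -/
theorem eigenJ_general_spectrum {m : ℕ} (hm : 1 ≤ m)
    (T : Matrix (Fin m) (Fin m) ℂ) (hT : T.PosDef)
    (d : Fin m → ℝ) (hd : ∀ i, d i ≠ 0)
    (hTD : (T + Matrix.diagonal (fun i => (d i : ℂ))).PosDef) :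
    IsUnit (1 + T⁻¹ * Matrix.diagonal (fun i => (d i : ℂ))) ∧
    (∃ (U : Matrix (Fin m) (Fin m) ℂ) (e : Fin m → ℂ), IsUnit U ∧
      (1 + T⁻¹ * Matrix.diagonal (fun i => (d i : ℂ)))⁻¹ = U * Matrix.diagonal e * U⁻¹) ∧
    (∀ μ ∈ spectrum ℂ ((1 + T⁻¹ * Matrix.diagonal (fun i => (d i : ℂ)))⁻¹),
      μ.im = 0 ∧ 0 < μ.re ∧ μ.re ≠ 1) ∧
    ((∃ i, d i < 0) →
      ∃ μ ∈ spectrum ℂ ((1 + T⁻¹ * Matrix.diagonal (fun i => (d i : ℂ)))⁻¹),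
        1 < μ.re) := by
  set D : Matrix (Fin m) (Fin m) ℂ := diagonal (fun i => (d i : ℂ)) with hD
  obtain ⟨U, e, hU, hUA, hUT⟩ := exists_simultaneous_diagonalization hTD hT.isHermitian
  have hfac : 1 + T⁻¹ * D = T⁻¹ * (T + D) := by
    rw [mul_add, nonsing_inv_mul T ((isUnit_iff_isUnit_det T).mp hT.isUnit)]
  have hUD : star U * D * U = diagonal (fun i => ((1 - e i : ℝ) : ℂ)) := by
    have h : star U * D * U = star U * (T + D) * U - star U * T * U := by noncomm_ring
    rw [h, hUA, hUT, ← diagonal_one, diagonal_sub]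
    simp
  have he_pos : ∀ i, 0 < e i := by
    have h := (IsUnit.posDef_star_left_conjugate_iff hU).mpr hT
    rw [hUT, posDef_diagonal_iff] at h
    exact fun i => by exact_mod_cast h i
  have he_ne : ∀ i, e i ≠ 1 := by
    have hDu : IsUnit D := by
      rw [hD, isUnit_diagonal, Pi.isUnit_iff]
      exact fun i => isUnit_iff_ne_zero.mpr (by exact_mod_cast hd i)
    have h := (hU.star.mul hDu).mul hU
    rw [hUD, isUnit_diagonal, Pi.isUnit_iff] at h
    intro i hi
    simpa [hi] using h i
  have hunit : IsUnit (1 + T⁻¹ * D) := hfac ▸ hT.inv.isUnit.mul hTD.isUnit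
  have hJ : (1 + T⁻¹ * D)⁻¹ = U * diagonal (fun i => (e i : ℂ)) * U⁻¹ := by
    have hinv : (T + D)⁻¹ = U * star U := by
      refine inv_eq_left_inv ?_
      rw [mul_assoc]
      exact mul_eq_one_comm.mp hUA
    rw [hfac, Matrix.mul_inv_rev, nonsing_inv_nonsing_inv T ((isUnit_iff_isUnit_det T).mp hT.isUnit),
      hinv, ← hUT]
    simp only [mul_assoc]
    rw [mul_nonsing_inv U ((isUnit_iff_isUnit_det U).mp hU), mul_one]
  have hspec : spectrum ℂ (1 + T⁻¹ * D)⁻¹ = Set.range (fun i => (e i : ℂ)) := by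
    rw [hJ, ← spectrum_diagonal]
    lift U to (Matrix (Fin m) (Fin m) ℂ)ˣ using hU
    rw [← coe_units_inv, spectrum.units_conjugate]
  refine ⟨hunit, ⟨U, _, hU, hJ⟩, ?_, ?_⟩
  · rw [hspec]
    rintro _ ⟨i, rfl⟩
    simpa using ⟨he_pos i, he_ne i⟩
  · rintro ⟨i, hi⟩
    rw [hspec]
    by_contra! hle
    have h : (star U * D * U).PosSemidef := by
      rw [hUD, posSemidef_diagonal_iff]
      intro j
      have := hle _ ⟨j, rfl⟩
      rw [Complex.ofReal_re] at this
      exact_mod_cast sub_nonneg.mpr this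
    rw [IsUnit.posSemidef_star_left_conjugate_iff hU, hD, posSemidef_diagonal_iff] at h
    exact absurd hi (not_lt.mpr (by exact_mod_cast h i))
end

section
/- Let A and B be N×N Hermitian complex matrices with B negative definite, let 1 ≤ n < N, assume the spectral gap λ_g := λ_{n+1}{A+B} − λ_n{A+B} > 0, and let P be the (unique) bottom-n eigenprojector of A+B. Set γ̄ := ‖B‖₂ / (‖B‖₂ + λ_g). Then for every ρ with γ̄ < ρ < 1 there exist constants C, c > 0 such that the following holds: for any sequence (P^(k))_{k≥0} of rank-n orthogonal projectors on ℂ^N in which, for each k ≥ 0, P^(k+1) is a bottom-n eigenprojector of A+B̃[P^(k)], if ‖P^(0) − P‖₂ ≤ c then ‖P^(k) − P‖₂ ≤ C·ρ^k·‖P^(0) − P‖₂ for all k ≥ 0. -/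
open Matrix
open scoped ComplexOrder

/-- The real part of the sesquilinear form `x*Hx`. -/
noncomputable abbrev reQuad {N : ℕ} (H : Matrix (Fin N) (Fin N) ℂ) (x : Fin N → ℂ) : ℝ :=
  (star x ⬝ᵥ H *ᵥ x).re

/-- The squared Euclidean norm `x*x`. -/
noncomputable abbrev normSqVec {N : ℕ} (x : Fin N → ℂ) : ℝ := (star x ⬝ᵥ x).re

lemma normSqVec_eq_sum {N : ℕ} (x : Fin N → ℂ) : normSqVec x = ∑ i, ‖x i‖ ^ 2 := by
  simp [normSqVec, dotProduct, ← Complex.normSq_eq_norm_sq, Complex.normSq_apply]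

lemma normSqVec_pos {N : ℕ} {x : Fin N → ℂ} (hx : x ≠ 0) : 0 < normSqVec x := by
  obtain ⟨i, hi⟩ := Function.ne_iff.mp hx
  rw [normSqVec_eq_sum]
  exact Finset.sum_pos' (fun _ _ => by positivity) ⟨i, Finset.mem_univ _, pow_pos (norm_pos_iff.mpr hi) 2⟩

lemma reQuad_add {N : ℕ} (G H : Matrix (Fin N) (Fin N) ℂ) (x : Fin N → ℂ) :
    reQuad (G + H) x = reQuad G x + reQuad H x := by
  simp [reQuad, add_mulVec, dotProduct_add]

lemma reQuad_sub {N : ℕ} (G H : Matrix (Fin N) (Fin N) ℂ) (x : Fin N → ℂ) :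
    reQuad (G - H) x = reQuad G x - reQuad H x := by
  simp [reQuad, sub_mulVec, dotProduct_sub]

lemma reQuad_neg {N : ℕ} (G : Matrix (Fin N) (Fin N) ℂ) (x : Fin N → ℂ) :
    reQuad (-G) x = -reQuad G x := by
  simp [reQuad, neg_mulVec, dotProduct_neg]

lemma Matrix.PosSemidef.reQuad_nonneg {N : ℕ} {D : Matrix (Fin N) (Fin N) ℂ} (hD : D.PosSemidef)
    (x : Fin N → ℂ) : 0 ≤ reQuad D x :=
  hD.re_dotProduct_nonneg x

lemma reQuad_conj {N : ℕ} (G U : Matrix (Fin N) (Fin N) ℂ) (x : Fin N → ℂ) :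
    reQuad (U * G * Uᴴ) x = reQuad G (Uᴴ *ᵥ x) := by
  simp only [reQuad, star_mulVec, conjTranspose_conjTranspose, dotProduct_mulVec, vecMul_vecMul,
    Matrix.mul_assoc]

/-- Sorted diagonalization of the quadratic form of a Hermitian matrix. -/
lemma exists_sorted_diagonalization {N : ℕ} {G : Matrix (Fin N) (Fin N) ℂ} (hG : G.IsHermitian) :
    ∃ (s : Fin N → ℝ) (c : (Fin N → ℂ) →ₗ[ℂ] (Fin N → ℂ)), Monotone s ∧
      (∀ i : Fin N, eig G (i + 1) = s i) ∧
      (∀ x, reQuad G x = ∑ i, s i * ‖c x i‖ ^ 2) ∧ ∀ x, normSqVec x = ∑ i, ‖c x i‖ ^ 2 := by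
  set σ := Tuple.sort hG.eigenvalues with hσ
  set U : Matrix (Fin N) (Fin N) ℂ := (hG.eigenvectorUnitary : Matrix (Fin N) (Fin N) ℂ) with hU
  have hGU : G = U * diagonal (fun i => (hG.eigenvalues i : ℂ)) * Uᴴ := by
    conv_lhs => rw [hG.spectral_theorem, Unitary.conjStarAlgAut_apply]
    rfl
  have hUU : U * 1 * Uᴴ = 1 := by
    rw [Matrix.mul_one]
    exact Unitary.mul_star_self_of_mem hG.eigenvectorUnitary.2
  refine ⟨hG.eigenvalues ∘ σ, LinearMap.funLeft ℂ ℂ σ ∘ₗ Uᴴ.mulVecLin,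
    Tuple.monotone_sort _, fun i => ?_, fun x => ?_, fun x => ?_⟩
  · simp [eig, hG, hσ]
  · conv_lhs => rw [hGU]
    rw [reQuad_conj]
    simp only [Function.comp_apply, LinearMap.comp_apply, LinearMap.funLeft_apply,
      mulVecLin_apply]
    rw [Equiv.sum_comp σ (fun i => hG.eigenvalues i * ‖(Uᴴ *ᵥ x) i‖ ^ 2)]
    simp only [reQuad, dotProduct, mulVec_diagonal, Pi.star_apply, Complex.re_sum]
    refine Finset.sum_congr rfl fun i _ => ?_
    simp only [← Complex.normSq_eq_norm_sq, Complex.normSq_apply, RCLike.star_def,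
      Complex.mul_re, Complex.conj_re, Complex.conj_im, Complex.ofReal_re, Complex.ofReal_im,
      Complex.mul_im]
    ring
  · have h := reQuad_conj 1 U x
    rw [hUU] at h
    simp only [reQuad, one_mulVec] at h
    simp only [LinearMap.comp_apply, LinearMap.funLeft_apply, mulVecLin_apply]
    rw [Equiv.sum_comp σ (fun i => ‖(Uᴴ *ᵥ x) i‖ ^ 2), ← normSqVec_eq_sum]
    exact h

/-- Courant–Fischer upper bound. -/
lemma eig_le_of_subspace {N k : ℕ} {G : Matrix (Fin N) (Fin N) ℂ} (hG : G.IsHermitian)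
    (W : Submodule ℂ (Fin N → ℂ)) (hk : k < Module.finrank ℂ W) {a : ℝ}
    (h : ∀ x ∈ W, reQuad G x ≤ a * normSqVec x) : eig G (k + 1) ≤ a := by
  obtain ⟨s, c, hs, hse, hq, hn⟩ := exists_sorted_diagonalization hG
  have hkN : k < N := by simpa using hk.trans_le W.finrank_le
  let f : W →ₗ[ℂ] (Fin k → ℂ) :=
    LinearMap.funLeft ℂ ℂ (fun i : Fin k => (⟨i, i.2.trans hkN⟩ : Fin N)) ∘ₗ c ∘ₗ W.subtype
  obtain ⟨x, hx, hx0⟩ := Submodule.exists_mem_ne_zero_of_ne_bot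
    (LinearMap.ker_ne_bot_of_finrank_lt (f := f) (by simpa using hk))
  have hx0' : (x : Fin N → ℂ) ≠ 0 := by simpa using hx0
  have hzero : ∀ i : Fin N, (i : ℕ) < k → c x i = 0 := fun i hi =>
    congrFun (LinearMap.mem_ker.mp hx) ⟨i, hi⟩
  have hle : eig G (k + 1) * normSqVec (x : Fin N → ℂ) ≤ a * normSqVec (x : Fin N → ℂ) := by
    refine le_trans ?_ (h x x.2)
    rw [hq, hn, Finset.mul_sum, hse ⟨k, hkN⟩]
    refine Finset.sum_le_sum fun i _ => ?_
    by_cases hi : (i : ℕ) < k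
    · simp [hzero i hi]
    · exact mul_le_mul_of_nonneg_right (hs (Fin.le_def.mpr (not_lt.mp hi))) (by positivity)
  exact le_of_mul_le_mul_right hle (normSqVec_pos hx0')

/-- Courant–Fischer lower bound. -/
lemma le_eig_of_subspace {N k : ℕ} {G : Matrix (Fin N) (Fin N) ℂ} (hG : G.IsHermitian)
    (W : Submodule ℂ (Fin N → ℂ)) (hkN : k < N) (hk : N ≤ Module.finrank ℂ W + k) {b : ℝ}
    (h : ∀ x ∈ W, b * normSqVec x ≤ reQuad G x) : b ≤ eig G (k + 1) := by
  obtain ⟨s, c, hs, hse, hq, hn⟩ := exists_sorted_diagonalization hG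
  let f : W →ₗ[ℂ] (Fin (N - (k + 1)) → ℂ) :=
    LinearMap.funLeft ℂ ℂ (fun i : Fin (N - (k + 1)) => (⟨i + (k + 1), by omega⟩ : Fin N)) ∘ₗ
      c ∘ₗ W.subtype
  obtain ⟨x, hx, hx0⟩ := Submodule.exists_mem_ne_zero_of_ne_bot
    (LinearMap.ker_ne_bot_of_finrank_lt (f := f) (by simp; omega))
  have hx0' : (x : Fin N → ℂ) ≠ 0 := by simpa using hx0
  have hzero : ∀ i : Fin N, k < (i : ℕ) → c x i = 0 := fun i hi => by
    have := congrFun (LinearMap.mem_ker.mp hx) ⟨i - (k + 1), by omega⟩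
    simp only [f, LinearMap.comp_apply, LinearMap.funLeft_apply, Submodule.subtype_apply,
      Nat.sub_add_cancel (Nat.succ_le_of_lt hi)] at this
    exact this
  have hle : b * normSqVec (x : Fin N → ℂ) ≤ eig G (k + 1) * normSqVec (x : Fin N → ℂ) := by
    refine (h x x.2).trans ?_
    rw [hq, hn, Finset.mul_sum, hse ⟨k, hkN⟩]
    refine Finset.sum_le_sum fun i _ => ?_
    by_cases hi : k < (i : ℕ)
    · simp [hzero i hi]
    · exact mul_le_mul_of_nonneg_right (hs (Fin.le_def.mpr (not_lt.mp hi))) (by positivity)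
  exact le_of_mul_le_mul_right hle (normSqVec_pos hx0')

lemma IsProjOfRank.mulVec_eq_of_mem_range {N n : ℕ} {P : Matrix (Fin N) (Fin N) ℂ}
    (hP : IsProjOfRank n P) {x : Fin N → ℂ} (hx : x ∈ LinearMap.range P.mulVecLin) :
    P *ᵥ x = x := by
  obtain ⟨y, rfl⟩ := hx
  simp [mulVec_mulVec, hP.2.1]

lemma IsProjOfRank.finrank_range {N n : ℕ} {P : Matrix (Fin N) (Fin N) ℂ}
    (hP : IsProjOfRank n P) : Module.finrank ℂ (LinearMap.range P.mulVecLin) = n := hP.2.2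

lemma IsProjOfRank.finrank_ker {N n : ℕ} {P : Matrix (Fin N) (Fin N) ℂ}
    (hP : IsProjOfRank n P) : n + Module.finrank ℂ (LinearMap.ker P.mulVecLin) = N := by
  have := P.mulVecLin.finrank_range_add_finrank_ker
  rwa [hP.finrank_range, Module.finrank_fin_fun] at this

/-- The trace of an orthogonal projector is its rank. -/
lemma IsProjOfRank.trace_eq {N n : ℕ} {P : Matrix (Fin N) (Fin N) ℂ}
    (hP : IsProjOfRank n P) : P.trace = n := by
  have h : LinearMap.IsProj (LinearMap.range P.mulVecLin) P.mulVecLin :=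
    ⟨fun x => ⟨x, rfl⟩, fun x hx => hP.mulVec_eq_of_mem_range hx⟩
  have := h.trace
  rwa [hP.finrank_range, ← Matrix.toLin'_apply', Matrix.trace_toLin'_eq] at this

/-- Across a spectral gap, the form is bounded below on the kernel of a bottom eigenprojector. -/
lemma IsBottomEigenproj.le_reQuad_of_ker {N n : ℕ} {G R : Matrix (Fin N) (Fin N) ℂ}
    (hG : G.IsHermitian) (hR : IsBottomEigenproj n G R) (hgap : eig G n < eig G (n + 1))
    {x : Fin N → ℂ} (hx : R *ᵥ x = 0) : eig G (n + 1) * normSqVec x ≤ reQuad G x := by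
  obtain ⟨hRp, hcomm, hbot⟩ := hR
  by_contra! hlt
  have hx0 : x ≠ 0 := by
    rintro rfl
    simp [normSqVec, reQuad] at hlt
  have hxp := normSqVec_pos hx0
  set a := max (eig G n) (reQuad G x / normSqVec x) with ha
  have haq : reQuad G x ≤ a * normSqVec x := by
    rw [← div_le_iff₀ hxp]
    exact le_max_right _ _
  have ha_lt : a < eig G (n + 1) := max_lt hgap (by rwa [div_lt_iff₀ hxp])
  set W := LinearMap.range R.mulVecLin ⊔ Submodule.span ℂ {x} with hW
  have hdisj : Disjoint (LinearMap.range R.mulVecLin) (Submodule.span ℂ {x}) := by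
    rw [Submodule.disjoint_def]
    intro y hy hyx
    obtain ⟨t, rfl⟩ := Submodule.mem_span_singleton.mp hyx
    rw [← hRp.mulVec_eq_of_mem_range hy, mulVec_smul, hx, smul_zero]
  have hfin : Module.finrank ℂ W = n + 1 := by
    have := Submodule.finrank_sup_add_finrank_inf_eq (LinearMap.range R.mulVecLin)
      (Submodule.span ℂ {x})
    rwa [hdisj.eq_bot, finrank_bot, hRp.finrank_range, finrank_span_singleton hx0,
      add_zero] at this
  refine absurd (eig_le_of_subspace (k := n) hG W (by omega) (a := a) ?_) (not_le.mpr ha_lt)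
  intro y hy
  obtain ⟨r, hr, w, hw, rfl⟩ := Submodule.mem_sup.mp hy
  obtain ⟨t, rfl⟩ := Submodule.mem_span_singleton.mp hw
  have hRr := hRp.mulVec_eq_of_mem_range hr
  have hrx : star r ⬝ᵥ x = 0 := by
    rw [← hRr, star_mulVec, hRp.1.eq, ← dotProduct_mulVec, hx, dotProduct_zero]
  have hxR : star x ᵥ* R = 0 := by
    have := congrArg star hx
    rwa [star_mulVec, hRp.1.eq, star_zero] at this
  have hxr : star x ⬝ᵥ r = 0 := by
    rw [← hRr, dotProduct_mulVec, hxR, zero_dotProduct]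
  have hrGx : star r ⬝ᵥ G *ᵥ x = 0 := by
    rw [← hRr, star_mulVec, hRp.1.eq, ← dotProduct_mulVec, mulVec_mulVec, ← hcomm,
      ← mulVec_mulVec, hx, mulVec_zero, dotProduct_zero]
  have hxGr : star x ⬝ᵥ G *ᵥ r = 0 := by
    rw [← hRr, mulVec_mulVec, hcomm, ← mulVec_mulVec, dotProduct_mulVec, hxR, zero_dotProduct]
  have h1 : reQuad G (r + t • x) = reQuad G r + ‖t‖ ^ 2 * reQuad G x := by
    simp only [reQuad, star_add, star_smul, mulVec_add, mulVec_smul, dotProduct_add,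
      add_dotProduct, smul_dotProduct, dotProduct_smul, hrGx, hxGr, zero_add,
      smul_eq_mul, Complex.add_re, ← mul_assoc]
    rw [← Complex.normSq_eq_norm_sq]
    simp [Complex.normSq_apply, mul_comm]
  have h2 : normSqVec (r + t • x) = normSqVec r + ‖t‖ ^ 2 * normSqVec x := by
    simp only [normSqVec, star_add, star_smul, dotProduct_add,
      add_dotProduct, smul_dotProduct, dotProduct_smul, hrx, hxr, zero_add,
      smul_eq_mul, Complex.add_re, ← mul_assoc]
    rw [← Complex.normSq_eq_norm_sq]
    simp [Complex.normSq_apply, mul_comm]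
  rw [h1, h2]
  have h3 := hbot r ⟨r, hRr.symm⟩
  have h4 : eig G n * normSqVec r ≤ a * normSqVec r := by
    refine mul_le_mul_of_nonneg_right (le_max_left _ _) ?_
    rw [normSqVec_eq_sum]
    positivity
  have h5 := mul_le_mul_of_nonneg_left haq (sq_nonneg ‖t‖)
  change reQuad G r ≤ _ at h3
  linarith

section Frobenius

open scoped Matrix.Norms.Frobenius

variable {N n : ℕ}

/-- The real part of the trace form `tr(Y*GY)`. -/
noncomputable abbrev reTraceForm (G Y : Matrix (Fin N) (Fin N) ℂ) : ℝ :=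
  (Yᴴ * G * Y).trace.re

lemma reTraceForm_eq_sum (G Y : Matrix (Fin N) (Fin N) ℂ) :
    reTraceForm G Y = ∑ j, reQuad G (Y.col j) := by
  rw [reTraceForm, trace, Complex.re_sum]
  refine Finset.sum_congr rfl fun j _ => ?_
  rw [diag_apply, Matrix.mul_assoc, mul_apply']
  rfl

lemma frobenius_normSq_eq_sum (Y : Matrix (Fin N) (Fin N) ℂ) :
    ‖Y‖ ^ 2 = ∑ j, normSqVec (Y.col j) := by
  have h : ‖Y‖ ^ 2 = ∑ i, ∑ j, ‖Y i j‖ ^ 2 := by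
    rw [frobenius_norm_def, ← Real.rpow_natCast, ← Real.rpow_mul (by positivity)]
    norm_num
  rw [h, Finset.sum_comm]
  exact Finset.sum_congr rfl fun j _ => (normSqVec_eq_sum _).symm

lemma frobenius_normSq_eq_trace (Y : Matrix (Fin N) (Fin N) ℂ) :
    ‖Y‖ ^ 2 = (Yᴴ * Y).trace.re := by
  rw [frobenius_normSq_eq_sum, trace, Complex.re_sum]
  refine Finset.sum_congr rfl fun j _ => ?_
  rw [diag_apply, mul_apply']
  rfl

lemma le_reTraceForm {G Y : Matrix (Fin N) (Fin N) ℂ} {b : ℝ}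
    (h : ∀ j, b * normSqVec (Y.col j) ≤ reQuad G (Y.col j)) : b * ‖Y‖ ^ 2 ≤ reTraceForm G Y := by
  rw [reTraceForm_eq_sum, frobenius_normSq_eq_sum, Finset.mul_sum]
  exact Finset.sum_le_sum fun j _ => h j

lemma reTraceForm_le {G Y : Matrix (Fin N) (Fin N) ℂ} {a : ℝ}
    (h : ∀ j, reQuad G (Y.col j) ≤ a * normSqVec (Y.col j)) : reTraceForm G Y ≤ a * ‖Y‖ ^ 2 := by
  rw [reTraceForm_eq_sum, frobenius_normSq_eq_sum, Finset.mul_sum]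
  exact Finset.sum_le_sum fun j _ => h j

lemma reTraceForm_mono {G H Y : Matrix (Fin N) (Fin N) ℂ} (h : (H - G).PosSemidef) :
    reTraceForm G Y ≤ reTraceForm H Y := by
  rw [reTraceForm_eq_sum, reTraceForm_eq_sum]
  refine Finset.sum_le_sum fun j _ => ?_
  have := h.reQuad_nonneg (Y.col j)
  rw [reQuad_sub] at this
  linarith

lemma Matrix.PosSemidef.reTraceForm_nonneg {D : Matrix (Fin N) (Fin N) ℂ} (hD : D.PosSemidef)
    (Y : Matrix (Fin N) (Fin N) ℂ) : 0 ≤ reTraceForm D Y := by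
  rw [reTraceForm_eq_sum]
  exact Finset.sum_nonneg fun j _ => hD.reQuad_nonneg _

lemma mulVec_col_eq (P Y : Matrix (Fin N) (Fin N) ℂ) (j : Fin N) :
    P *ᵥ Y.col j = (P * Y).col j := rfl

lemma exists_re_trace_le_norm (N : ℕ) :
    ∃ K : ℝ, 0 < K ∧ ∀ M : Matrix (Fin N) (Fin N) ℂ, |M.trace.re| ≤ K * ‖M‖ := by
  obtain ⟨K, hK, h⟩ := (LinearMap.toContinuousLinearMap
    (Matrix.traceLinearMap (Fin N) ℂ ℂ)).isBoundedLinearMap.bound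
  exact ⟨K, hK, fun M => (Complex.abs_re_le_norm _).trans (h M)⟩

lemma exists_specNorm_le_norm (N : ℕ) :
    ∃ K : ℝ, 0 < K ∧ ∀ M : Matrix (Fin N) (Fin N) ℂ, specNorm M ≤ K * ‖M‖ := by
  obtain ⟨K, hK, h⟩ := (LinearMap.toContinuousLinearMap
    ((Matrix.toEuclideanLin (𝕜 := ℂ) (m := Fin N) (n := Fin N)).trans
      LinearMap.toContinuousLinearMap).toLinearMap).isBoundedLinearMap.bound
  exact ⟨K, hK, h⟩

lemma exists_norm_le_specNorm (N : ℕ) :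
    ∃ K : ℝ, 0 < K ∧ ∀ M : Matrix (Fin N) (Fin N) ℂ, ‖M‖ ≤ K * specNorm M := by
  set e := (Matrix.toEuclideanLin (𝕜 := ℂ) (m := Fin N) (n := Fin N)).trans
      LinearMap.toContinuousLinearMap with he
  obtain ⟨K, hK, h⟩ := (LinearMap.toContinuousLinearMap
    e.symm.toLinearMap).isBoundedLinearMap.bound
  refine ⟨K, hK, fun M => ?_⟩
  have hM : ‖e.symm (e M)‖ ≤ K * ‖e M‖ := h (e M)
  rwa [e.symm_apply_apply] at hM

lemma abs_reQuad_le_specNorm (Z : Matrix (Fin N) (Fin N) ℂ) (x : Fin N → ℂ) :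
    |reQuad Z x| ≤ specNorm Z * normSqVec x := by
  set v : EuclideanSpace ℂ (Fin N) := WithLp.toLp 2 x with hv
  set T := LinearMap.toContinuousLinearMap (Matrix.toEuclideanLin Z) with hT
  have h1 : reQuad Z x = (inner ℂ v (T v)).re := by
    rw [EuclideanSpace.inner_eq_star_dotProduct, dotProduct_comm]
    rfl
  have h2 : normSqVec x = ‖v‖ ^ 2 := by
    rw [EuclideanSpace.norm_sq_eq, normSqVec_eq_sum]
  rw [h1, h2]
  calc |(inner ℂ v (T v)).re| ≤ ‖inner ℂ v (T v)‖ := Complex.abs_re_le_norm _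
    _ ≤ ‖v‖ * ‖T v‖ := norm_inner_le_norm _ _
    _ ≤ ‖v‖ * (‖T‖ * ‖v‖) := by gcongr; exact T.le_opNorm v
    _ = specNorm Z * ‖v‖ ^ 2 := by rw [specNorm]; ring

lemma IsProjOfRank.norm_mul_le {P : Matrix (Fin N) (Fin N) ℂ} (hP : IsProjOfRank n P)
    (Z : Matrix (Fin N) (Fin N) ℂ) : ‖P * Z‖ ≤ ‖Z‖ ∧ ‖(1 - P) * Z‖ ≤ ‖Z‖ := by
  have h : ‖Z‖ ^ 2 = ‖P * Z‖ ^ 2 + ‖(1 - P) * Z‖ ^ 2 := by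
    simp only [frobenius_normSq_eq_trace, ← Complex.add_re, ← trace_add, conjTranspose_mul,
      conjTranspose_sub, conjTranspose_one, hP.1.eq]
    have : Zᴴ * P * (P * Z) + Zᴴ * (1 - P) * ((1 - P) * Z) =
        Zᴴ * (P * P) * Z + Zᴴ * (1 - P - P + P * P) * Z := by noncomm_ring
    rw [this, hP.2.1]
    congr 2
    noncomm_ring
  constructor <;> refine le_of_sq_le_sq ?_ (norm_nonneg _)
  · nlinarith [sq_nonneg ‖(1 - P) * Z‖]
  · nlinarith [sq_nonneg ‖P * Z‖]

lemma IsProjOfRank.norm_mul_le' {P : Matrix (Fin N) (Fin N) ℂ} (hP : IsProjOfRank n P)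
    (Z : Matrix (Fin N) (Fin N) ℂ) : ‖Z * P‖ ≤ ‖Z‖ ∧ ‖Z * (1 - P)‖ ≤ ‖Z‖ := by
  have h := hP.norm_mul_le Zᴴ
  rw [← frobenius_norm_conjTranspose, ← frobenius_norm_conjTranspose (_ * _)] at h
  simpa [hP.1.eq] using h

/-- Near `P`, the distance of a projector to `P` is controlled by its off-diagonal block. -/
lemma IsProjOfRank.norm_sub_le_offDiag {P Q : Matrix (Fin N) (Fin N) ℂ} (hP : IsProjOfRank n P)
    (hQ : IsProjOfRank n Q) (hd : ‖Q - P‖ ≤ 1 / 4) : ‖Q - P‖ ≤ 4 * ‖(1 - P) * Q * P‖ := by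
  set Δ := Q - P with hΔ
  have hQ' : Q = P + Δ := by rw [hΔ]; abel
  have hPP := hP.2.1
  have hQQ : (P + Δ) * (P + Δ) = P + Δ := hQ' ▸ hQ.2.1
  have hX : (1 - P) * Q * P = (1 - P) * Δ * P := by
    rw [hQ', mul_add, sub_mul, hPP, one_mul, sub_self, zero_add]
  have h1 : Δ = P * Δ + Δ * P + Δ * Δ := by
    have : (P + Δ) * (P + Δ) = P * P + (P * Δ + Δ * P + Δ * Δ) := by noncomm_ring
    rw [this, hPP] at hQQ
    exact (add_left_cancel hQQ).symm
  have h2 : P * Δ * P = -(P * (Δ * Δ) * P) := by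
    have : P * Δ * P = P * P * Δ * P + P * Δ * (P * P) + P * (Δ * Δ) * P := by
      conv_lhs => rw [h1]
      noncomm_ring
    rw [hPP, add_assoc] at this
    exact eq_neg_of_add_eq_zero_left (left_eq_add.mp this)
  have h3 : (1 - P) * Δ * (1 - P) = (1 - P) * (Δ * Δ) * (1 - P) := by
    have e : (1 - P) * P = 0 := by rw [sub_mul, hPP, one_mul, sub_self]
    have e' : P * (1 - P) = 0 := by rw [mul_sub, hPP, mul_one, sub_self]
    have : (1 - P) * Δ * (1 - P) = ((1 - P) * P) * Δ * (1 - P) + (1 - P) * Δ * (P * (1 - P))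
        + (1 - P) * (Δ * Δ) * (1 - P) := by
      conv_lhs => rw [h1]
      noncomm_ring
    rwa [e, e', zero_mul, zero_mul, mul_zero, zero_add, zero_add] at this
  have hdec : Δ = (1 - P) * Δ * P + P * Δ * (1 - P) + P * Δ * P + (1 - P) * Δ * (1 - P) := by
    noncomm_ring
  have hsymm : ‖P * Δ * (1 - P)‖ = ‖(1 - P) * Δ * P‖ := by
    rw [← frobenius_norm_conjTranspose]
    simp [hΔ, hP.1.eq, hQ.1.eq, mul_assoc]
  have hsq : ‖Δ * Δ‖ ≤ ‖Δ‖ * ‖Δ‖ := frobenius_norm_mul _ _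
  have h4 : ‖P * Δ * P‖ ≤ ‖Δ‖ * ‖Δ‖ := by
    rw [h2, norm_neg]
    exact ((hP.norm_mul_le' _).1.trans (hP.norm_mul_le _).1).trans hsq
  have h5 : ‖(1 - P) * Δ * (1 - P)‖ ≤ ‖Δ‖ * ‖Δ‖ := by
    rw [h3]
    exact ((hP.norm_mul_le' _).2.trans (hP.norm_mul_le _).2).trans hsq
  have h6 : ‖Δ‖ ≤ ‖(1 - P) * Δ * P‖ + ‖(1 - P) * Δ * P‖ + ‖Δ‖ * ‖Δ‖ + ‖Δ‖ * ‖Δ‖ := by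
    conv_lhs => rw [hdec]
    refine (norm_add_le _ _).trans (add_le_add ((norm_add_le _ _).trans (add_le_add
      ((norm_add_le _ _).trans (add_le_add le_rfl hsymm.le)) h4)) h5)
  rw [hX]
  nlinarith [norm_nonneg Δ]

lemma IsProjOfRank.normSq_compl_mul {P R : Matrix (Fin N) (Fin N) ℂ} (hP : IsProjOfRank n P)
    (hR : IsProjOfRank n R) : ‖(1 - P) * R‖ ^ 2 = n - (P * R).trace.re := by
  have h : ((1 - P) * R)ᴴ * ((1 - P) * R) = R * (1 - P - P + P * P) * R := by
    rw [conjTranspose_mul, conjTranspose_sub, conjTranspose_one, hP.1.eq, hR.1.eq]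
    noncomm_ring
  rw [frobenius_normSq_eq_trace, h, hP.2.1, trace_mul_comm, ← mul_assoc, hR.2.1]
  have : R * (1 - P - P + P) = R - R * P := by noncomm_ring
  rw [this, trace_sub, hR.trace_eq, trace_mul_comm R P]
  simp

/-- For equal-rank projectors, the Frobenius distance is determined by one off-diagonal factor. -/
lemma IsProjOfRank.normSq_sub {P R : Matrix (Fin N) (Fin N) ℂ} (hP : IsProjOfRank n P)
    (hR : IsProjOfRank n R) : ‖R - P‖ ^ 2 = 2 * ‖(1 - P) * R‖ ^ 2 := by
  rw [hP.normSq_compl_mul hR, frobenius_normSq_eq_trace, conjTranspose_sub, hP.1.eq, hR.1.eq]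
  have : (R - P) * (R - P) = R * R - R * P - P * R + P * P := by noncomm_ring
  rw [this, hP.2.1, hR.2.1, trace_add, trace_sub, trace_sub, hP.trace_eq, hR.trace_eq,
    trace_mul_comm R P]
  simp
  ring

lemma IsProjOfRank.norm_mul_compl {P R : Matrix (Fin N) (Fin N) ℂ} (hP : IsProjOfRank n P)
    (hR : IsProjOfRank n R) : ‖P * (1 - R)‖ ^ 2 = ‖(1 - P) * R‖ ^ 2 := by
  rw [hP.normSq_compl_mul hR, trace_mul_comm, ← hR.normSq_compl_mul hP,
    ← frobenius_norm_conjTranspose]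
  simp [hP.1.eq, hR.1.eq]

/-- Quantitative variational principle for spectral projectors. -/
lemma IsProjOfRank.gap_mul_normSq_le {G P R : Matrix (Fin N) (Fin N) ℂ} {a b : ℝ}
    (hP : IsProjOfRank n P) (hR : IsProjOfRank n R) (hc : G * P = P * G)
    (ha : ∀ x, P *ᵥ x = x → reQuad G x ≤ a * normSqVec x)
    (hb : ∀ x, P *ᵥ x = 0 → b * normSqVec x ≤ reQuad G x) :
    (b - a) * ‖(1 - P) * R‖ ^ 2 ≤ (R * G).trace.re - (P * G).trace.re := by
  have hPP := hP.2.1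
  have h1 : b * ‖(1 - P) * R‖ ^ 2 ≤ reTraceForm G ((1 - P) * R) :=
    le_reTraceForm fun j => hb _ (by
      rw [mulVec_col_eq, ← mul_assoc, mul_sub, mul_one, hPP, sub_self, zero_mul]; rfl)
  have h2 : reTraceForm G (P * (1 - R)) ≤ a * ‖P * (1 - R)‖ ^ 2 :=
    reTraceForm_le fun j => ha _ (by rw [mulVec_col_eq, ← mul_assoc, hPP])
  have e1 : (((1 - P) * R)ᴴ * G * ((1 - P) * R)).trace = (R * G).trace - (R * (P * G)).trace := by
    have : ((1 - P) * R)ᴴ * G * ((1 - P) * R) = R * (((1 - P) * G * (1 - P)) * R) := by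
      rw [conjTranspose_mul, conjTranspose_sub, conjTranspose_one, hP.1.eq, hR.1.eq]
      noncomm_ring
    rw [this, trace_mul_comm, mul_assoc, hR.2.1, trace_mul_comm]
    have : (1 - P) * G * (1 - P) = G - G * P - P * G + P * (G * P) := by noncomm_ring
    rw [this, hc, ← mul_assoc P P, hPP, ← trace_sub]
    congr 1
    noncomm_ring
  have e2 : ((P * (1 - R))ᴴ * G * (P * (1 - R))).trace = (P * G).trace - (R * (P * G)).trace := by
    have hR1 : (1 - R) * (1 - R) = 1 - R := by
      have : (1 - R) * (1 - R) = 1 - R - R + R * R := by noncomm_ring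
      rw [this, hR.2.1]; abel
    have : (P * (1 - R))ᴴ * G * (P * (1 - R)) = (1 - R) * (P * (G * P) * (1 - R)) := by
      rw [conjTranspose_mul, conjTranspose_sub, conjTranspose_one, hP.1.eq, hR.1.eq]
      noncomm_ring
    rw [this, trace_mul_comm, mul_assoc, hR1, trace_mul_comm, hc, ← mul_assoc P P, hPP,
      sub_mul, one_mul, trace_sub]
  rw [hP.norm_mul_compl hR] at h2
  simp only [reTraceForm, e1, e2, Complex.sub_re] at h1 h2
  linarith

lemma isHermitian_compress {B Q : Matrix (Fin N) (Fin N) ℂ} (hB : B.IsHermitian)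
    (hQ : Q.IsHermitian) : (Q * B * Q + (1 - Q)).IsHermitian := by
  have : (Q * B * Q).IsHermitian := by
    simpa [hQ.eq] using isHermitian_mul_mul_conjTranspose Q hB
  exact this.add (isHermitian_one.sub hQ)

lemma isUnit_compress {B Q : Matrix (Fin N) (Fin N) ℂ} (hB : (-B).PosDef)
    (hQ : IsProjOfRank n Q) : IsUnit (Q * B * Q + (1 - Q)) := by
  rw [← mulVec_injective_iff_isUnit]
  rw [← coe_mulVecLin, ← LinearMap.ker_eq_bot, LinearMap.ker_eq_bot']
  intro x hx
  rw [mulVecLin_apply] at hx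
  have hQQ := hQ.2.1
  have h1 : Q *ᵥ x = x := by
    have h := congrArg ((1 - Q) *ᵥ ·) hx
    simp only [mulVec_mulVec, mulVec_zero] at h
    have e : (1 - Q) * (Q * B * Q + (1 - Q)) = 1 - Q := by
      have : (1 - Q) * (Q * B * Q + (1 - Q)) =
        Q * B * Q - Q * Q * B * Q + (1 - Q - Q + Q * Q) := by noncomm_ring
      rw [this, hQQ]; abel
    rw [e, sub_mulVec, one_mulVec, sub_eq_zero] at h
    exact h.symm
  have h2 : star x ⬝ᵥ (-B) *ᵥ x = 0 := by
    rw [add_mulVec, sub_mulVec, one_mulVec, h1, sub_self, add_zero, ← mulVec_mulVec, h1,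
      ← mulVec_mulVec] at hx
    have : star x ᵥ* Q = star x := by
      have := congrArg star h1
      rwa [star_mulVec, hQ.1.eq] at this
    rw [neg_mulVec, dotProduct_neg, neg_eq_zero, ← this, ← dotProduct_mulVec, hx, dotProduct_zero]
  by_contra hx0
  exact (hB.dotProduct_mulVec_pos hx0).ne' h2

/-- The defect `B̃[Q] - B` is positive semidefinite, dominated by `-B`, and annihilates `Q`. -/
lemma acomp_sub_props {B Q : Matrix (Fin N) (Fin N) ℂ} (hB : (-B).PosDef)
    (hQ : IsProjOfRank n Q) :
    (acomp B Q - B).PosSemidef ∧ (-B - (acomp B Q - B)).PosSemidef ∧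
      (acomp B Q - B) * Q = 0 := by
  have hBh : B.IsHermitian := by simpa using hB.1.neg
  set G := Q * B * Q + (1 - Q) with hG
  have hGh : G.IsHermitian := isHermitian_compress hBh hQ.1
  have hdet : IsUnit G.det := (isUnit_iff_isUnit_det G).mp (isUnit_compress hB hQ)
  have hQQ := hQ.2.1
  have hGQ : G * Q = Q * B * Q := by
    have : G * Q = Q * B * (Q * Q) + (Q - Q * Q) := by rw [hG]; noncomm_ring
    rw [this, hQQ, sub_self, add_zero]
  have hQG : Q * G = Q * B * Q := by
    have : Q * G = (Q * Q) * B * Q + (Q - Q * Q) := by rw [hG]; noncomm_ring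
    rw [this, hQQ, sub_self, add_zero]
  set K := G⁻¹ with hK
  have hKh : Kᴴ = K := hGh.inv.eq
  have hKG : K * G = 1 := nonsing_inv_mul G hdet
  have hGK : G * K = 1 := mul_nonsing_inv G hdet
  have hKQ : K * Q = Q * K := by
    calc K * Q = K * (Q * G) * K := by rw [mul_assoc, mul_assoc, hGK, mul_one]
      _ = Q * K := by rw [hQG, ← hGQ, ← mul_assoc, hKG, one_mul]
  set T := K - (1 - Q) with hT
  have hTh : Tᴴ = T := by simp [hT, hKh, hQ.1.eq]
  have hKc : K * (1 - Q) = 1 - Q := by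
    have : G * (1 - Q) = 1 - Q := by
      rw [mul_sub, mul_one, hGQ, hG]; abel
    calc K * (1 - Q) = K * (G * (1 - Q)) := by rw [this]
      _ = 1 - Q := by rw [← mul_assoc, hKG, one_mul]
  have hTQ : T = K * Q := by
    rw [hT, ← hKc]; noncomm_ring
  have hQT : T = Q * K := hTQ.trans hKQ
  have hTBQ : T * B * Q = Q := by
    calc T * B * Q = K * (Q * B * Q) := by rw [hTQ]; noncomm_ring
      _ = Q := by rw [← hGQ, ← mul_assoc, hKG, one_mul]
  have hTBT : T * B * T = T := by
    calc T * B * T = T * B * Q * K := by rw [mul_assoc _ Q, ← hQT]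
      _ = T := by rw [hTBQ, ← hQT]
  have hac : acomp B Q = B * T * B := by
    rw [acomp, ← hG, ← hK, hT]; noncomm_ring
  refine ⟨?_, ?_, ?_⟩
  · have h := hB.posSemidef.conjTranspose_mul_mul_same (1 - T * B)
    convert h using 1
    have : (1 - T * B)ᴴ * -B * (1 - T * B) = -B + 2 • (B * T * B) - B * (T * B * T) * B := by
      rw [conjTranspose_sub, conjTranspose_one, conjTranspose_mul, hTh, hBh.eq]
      noncomm_ring
    rw [this, hTBT, hac, two_smul]
    abel
  · have h := hB.posSemidef.conjTranspose_mul_mul_same (T * B)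
    convert h using 1
    have : (T * B)ᴴ * -B * (T * B) = -(B * (T * B * T) * B) := by
      rw [conjTranspose_mul, hTh, hBh.eq]
      noncomm_ring
    rw [this, hTBT, hac]
    abel
  · rw [hac, sub_mul, mul_assoc B T, mul_assoc B, hTBQ, sub_self]

lemma continuousAt_acomp {B Q : Matrix (Fin N) (Fin N) ℂ} (hB : (-B).PosDef)
    (hQ : IsProjOfRank n Q) : ContinuousAt (acomp B) Q := by
  have hdet : (Q * B * Q + (1 - Q)).det ≠ 0 :=
    ((isUnit_iff_isUnit_det _).mp (isUnit_compress hB hQ)).ne_zero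
  have h1 : ContinuousAt (fun Q : Matrix (Fin N) (Fin N) ℂ => (Q * B * Q + (1 - Q))⁻¹) Q := by
    refine ContinuousAt.comp (f := fun Q : Matrix (Fin N) (Fin N) ℂ => Q * B * Q + (1 - Q))
      (g := fun M => M⁻¹) (continuousAt_matrix_inv _ ?_) (by fun_prop)
    rw [Ring.inverse_eq_inv']
    exact continuousAt_inv₀ hdet
  unfold acomp
  fun_prop

/-- A priori linear bound on the distance of the updated projector to `P`. -/
lemma IsBottomEigenproj.gap_mul_normSq_sub_le {H D P Q R : Matrix (Fin N) (Fin N) ℂ}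
    (hn1 : 1 ≤ n) (hnN : n < N) (hH : H.IsHermitian) (hgap : eig H n < eig H (n + 1))
    (hP : IsBottomEigenproj n H P) (hQ : IsProjOfRank n Q) (hD : D.PosSemidef) (hDQ : D * Q = 0)
    (hR : IsBottomEigenproj n (H + D) R) {K L : ℝ}
    (hK : ∀ M : Matrix (Fin N) (Fin N) ℂ, |M.trace.re| ≤ K * ‖M‖) (hK0 : 0 ≤ K)
    (hL : ∀ M : Matrix (Fin N) (Fin N) ℂ, specNorm M ≤ L * ‖M‖) (hL0 : 0 ≤ L)
    (hsmall : L * (‖D‖ * ‖Q - P‖ ^ 2) < eig H (n + 1) - eig H n) :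
    (eig H (n + 1) - eig H n) * ‖R - P‖ ^ 2 ≤ 2 * (K * (‖D‖ * ‖Q - P‖ ^ 2)) := by
  have hPp := hP.1
  have hPker := fun x (hx : P *ᵥ x = 0) => hP.le_reQuad_of_ker hH hgap hx
  have hPran : ∀ x, P *ᵥ x = x → reQuad H x ≤ eig H n * normSqVec x :=
    fun x hx => hP.2.2 x ⟨x, hx.symm⟩
  have hQD : Q * D = 0 := by
    have := congrArg conjTranspose hDQ
    rwa [conjTranspose_mul, hQ.1.eq, hD.1.eq, conjTranspose_zero] at this
  have hPDP : P * D * P = (Q - P) * D * (Q - P) := by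
    have : (Q - P) * D * (Q - P) = Q * D * Q - Q * D * P - P * (D * Q) + P * D * P := by
      noncomm_ring
    rw [this, hQD, hDQ]; simp
  have hnorm : ‖P * D * P‖ ≤ ‖D‖ * ‖Q - P‖ ^ 2 := by
    rw [hPDP]
    calc _ ≤ ‖Q - P‖ * ‖D‖ * ‖Q - P‖ :=
          (norm_mul_le _ _).trans (mul_le_mul_of_nonneg_right (norm_mul_le _ _) (norm_nonneg _))
      _ = _ := by ring
  have hG : (H + D).IsHermitian := hH.add hD.1
  have hlow : eig H (n + 1) ≤ eig (H + D) (n + 1) := by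
    refine le_eig_of_subspace hG (LinearMap.ker P.mulVecLin) hnN
      (by have := hPp.finrank_ker; omega) fun x hx => ?_
    rw [reQuad_add]
    linarith [hPker x hx, hD.reQuad_nonneg x]
  have hup : eig (H + D) n ≤ eig H n + L * (‖D‖ * ‖Q - P‖ ^ 2) := by
    obtain ⟨k, rfl⟩ : ∃ k, n = k + 1 := ⟨n - 1, by omega⟩
    refine eig_le_of_subspace hG (LinearMap.range P.mulVecLin)
      (by rw [hPp.finrank_range]; omega) fun x hx => ?_
    have hx' := hPp.mulVec_eq_of_mem_range hx
    have h1 : reQuad D x = reQuad (P * D * P) x := by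
      have h := reQuad_conj D P x
      rw [hPp.1.eq, hx'] at h
      exact h.symm
    have h2 : 0 ≤ normSqVec x := by rw [normSqVec_eq_sum]; positivity
    have h3 : specNorm (P * D * P) ≤ L * (‖D‖ * ‖Q - P‖ ^ 2) :=
      (hL _).trans (mul_le_mul_of_nonneg_left hnorm hL0)
    have h4 := (le_abs_self _).trans (abs_reQuad_le_specNorm (P * D * P) x)
    have h5 := mul_le_mul_of_nonneg_right h3 h2
    rw [reQuad_add, h1, add_mul]
    linarith [hPran x hx']
  have hgap' : eig (H + D) n < eig (H + D) (n + 1) := by linarith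
  have hvarR := hR.1.gap_mul_normSq_le hPp hR.2.1 (fun x hx => hR.2.2 x ⟨x, hx.symm⟩)
    (fun x hx => hR.le_reQuad_of_ker hG hgap' hx)
  have hvarR' : 0 ≤ (P * (H + D)).trace.re - (R * (H + D)).trace.re :=
    le_trans (mul_nonneg (by linarith) (sq_nonneg _)) hvarR
  have hvarP := hPp.gap_mul_normSq_le hR.1 hP.2.1 hPran hPker
  have hRD : 0 ≤ (R * D).trace.re := by
    have h := hD.reTraceForm_nonneg R
    rwa [reTraceForm, hR.1.1.eq, trace_mul_comm, ← mul_assoc, hR.1.2.1] at h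
  have hPD : (P * D).trace.re ≤ K * (‖D‖ * ‖Q - P‖ ^ 2) := by
    have h : (P * D).trace = (P * D * P).trace := by
      rw [trace_mul_comm (P * D), ← mul_assoc, hPp.2.1]
    rw [h]
    exact (le_abs_self _).trans ((hK _).trans (mul_le_mul_of_nonneg_left hnorm hK0))
  rw [mul_add, mul_add, trace_add, trace_add, Complex.add_re, Complex.add_re] at hvarR'
  rw [hPp.normSq_sub hR.1]
  linarith

/-- The Sylvester-type equation satisfied by the off-diagonal blocks. -/
lemma offDiag_identity {H D D₀ P Q R : Matrix (Fin N) (Fin N) ℂ}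
    (hHP : H * P = P * H) (hc : (H + D) * R = R * (H + D)) (hDQ : D * Q = 0)
    (hD₀P : D₀ * P = 0) (hPD₀ : P * D₀ = 0) (hPP : P * P = P) :
    H * ((1 - P) * R * P) - (1 - P) * R * P * H + D₀ * ((1 - P) * R * P) =
      D₀ * ((1 - P) * Q * P) +
        ((1 - P) * (R - P) * D * (P - Q) * P - (1 - P) * (D - D₀) * (R - Q) * P) := by
  have h0 : (1 - P) * ((H + D) * R - R * (H + D)) * P = 0 := by rw [hc]; simp
  have e1 : (1 - P) * (R - P) * D * (P - Q) * P =
      (1 - P) * R * D * P - (1 - P) * R * (D * Q) * P - (P - P * P) * D * (P - Q) * P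
      + (1 - P) * R * D * (P * P - P) := by noncomm_ring
  have e2 : (1 - P) * (D - D₀) * (R - Q) * P = (1 - P) * D * R * P - (1 - P) * (D * Q) * P
      - D₀ * R * P + D₀ * Q * P + P * D₀ * (R - Q) * P := by noncomm_ring
  have e3 : H * ((1 - P) * R * P) = (1 - P) * H * R * P + (P * H - H * P) * R * P := by
    noncomm_ring
  have e4 : (1 - P) * R * P * H = (1 - P) * R * H * P + (1 - P) * R * (P * H - H * P) := by
    noncomm_ring
  have e5 : ∀ Z, D₀ * ((1 - P) * Z * P) = D₀ * Z * P - D₀ * P * Z * P := fun Z => by noncomm_ring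
  rw [e1, e2, e3, e4, e5, e5, hHP, hDQ, hD₀P, hPD₀, hPP]
  simp only [sub_self, zero_mul, mul_zero, add_zero, sub_zero]
  rw [← sub_eq_zero, ← h0]
  noncomm_ring

/-- The energy form of the linearized fixed-point equation. -/
noncomputable def energy (H D Y : Matrix (Fin N) (Fin N) ℂ) : ℝ :=
  (Yᴴ * (H * Y - Y * H + D * Y)).trace.re

lemma energy_ge {H D P Y : Matrix (Fin N) (Fin N) ℂ} {a b : ℝ}
    (ha : ∀ x, P *ᵥ x = x → reQuad H x ≤ a * normSqVec x)
    (hb : ∀ x, P *ᵥ x = 0 → b * normSqVec x ≤ reQuad H x)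
    (hPY : P * Y = 0) (hYP : P * Yᴴ = Yᴴ) :
    (b - a) * ‖Y‖ ^ 2 + reTraceForm D Y ≤ energy H D Y := by
  have h1 : b * ‖Y‖ ^ 2 ≤ reTraceForm H Y :=
    le_reTraceForm fun j => hb _ (by rw [mulVec_col_eq, hPY]; rfl)
  have h2 : reTraceForm H Yᴴ ≤ a * ‖Yᴴ‖ ^ 2 :=
    reTraceForm_le fun j => ha _ (by rw [mulVec_col_eq, hYP])
  rw [frobenius_norm_conjTranspose, reTraceForm, conjTranspose_conjTranspose,
    trace_mul_comm] at h2
  have h3 : energy H D Y = reTraceForm H Y - (Yᴴ * (Y * H)).trace.re + reTraceForm D Y := by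
    simp only [energy, reTraceForm, mul_add, mul_sub, trace_add, trace_sub, Complex.add_re,
      Complex.sub_re, mul_assoc]
  rw [h3]
  linarith

lemma energy_le {H D Y : Matrix (Fin N) (Fin N) ℂ} {K : ℝ} (hK0 : 0 ≤ K)
    (hK : ∀ M : Matrix (Fin N) (Fin N) ℂ, |M.trace.re| ≤ K * ‖M‖) :
    energy H D Y ≤ K * (2 * ‖H‖ + ‖D‖) * ‖Y‖ ^ 2 := by
  have h1 : ‖H * Y - Y * H + D * Y‖ ≤ ‖H‖ * ‖Y‖ + ‖Y‖ * ‖H‖ + ‖D‖ * ‖Y‖ :=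
    (norm_add_le _ _).trans (add_le_add ((norm_sub_le _ _).trans
      (add_le_add (norm_mul_le _ _) (norm_mul_le _ _))) (norm_mul_le _ _))
  have h2 : ‖Yᴴ * (H * Y - Y * H + D * Y)‖ ≤ ‖Y‖ * (‖H‖ * ‖Y‖ + ‖Y‖ * ‖H‖ + ‖D‖ * ‖Y‖) := by
    refine (norm_mul_le _ _).trans ?_
    rw [frobenius_norm_conjTranspose]
    exact mul_le_mul_of_nonneg_left h1 (norm_nonneg _)
  refine (le_abs_self _).trans ((hK _).trans ((mul_le_mul_of_nonneg_left h2 hK0).trans_eq ?_))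
  ring

/-- Weighted Cauchy–Schwarz inequality for a positive semidefinite form. -/
lemma Matrix.PosSemidef.two_mul_trace_le {D : Matrix (Fin N) (Fin N) ℂ} (hD : D.PosSemidef)
    (X Y : Matrix (Fin N) (Fin N) ℂ) (t : ℝ) :
    2 * t * (Yᴴ * (D * X)).trace.re ≤ reTraceForm D Y + t ^ 2 * reTraceForm D X := by
  have h := hD.reTraceForm_nonneg (Y - (t : ℂ) • X)
  have hs : (Xᴴ * (D * Y)).trace.re = (Yᴴ * (D * X)).trace.re := by
    have : (Xᴴ * (D * Y)) = (Yᴴ * (D * X))ᴴ := by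
      simp [conjTranspose_mul, hD.1.eq, mul_assoc]
    rw [this, trace_conjTranspose]
    simp
  simp only [reTraceForm, conjTranspose_sub, conjTranspose_smul, sub_mul, mul_sub, trace_sub,
    Matrix.smul_mul, Matrix.mul_smul, trace_smul, mul_assoc, Complex.sub_re, smul_eq_mul,
    RCLike.star_def, Complex.conj_ofReal, Complex.re_ofReal_mul] at h ⊢
  rw [hs] at h
  linarith

lemma offDiag_compl {P Z : Matrix (Fin N) (Fin N) ℂ} (hP : IsProjOfRank n P) :
    P * ((1 - P) * Z * P) = 0 ∧ P * ((1 - P) * Z * P)ᴴ = ((1 - P) * Z * P)ᴴ := by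
  have hPP := hP.2.1
  constructor
  · rw [← mul_assoc, ← mul_assoc, mul_sub, mul_one, hPP, sub_self, zero_mul, zero_mul]
  · rw [conjTranspose_mul, hP.1.eq, ← mul_assoc, hPP]

lemma IsProjOfRank.norm_offDiag_le {P Q : Matrix (Fin N) (Fin N) ℂ} (hP : IsProjOfRank n P) :
    ‖(1 - P) * Q * P‖ ≤ ‖Q - P‖ := by
  have h : (1 - P) * Q * P = (1 - P) * (Q - P) * P := by
    have : (1 - P) * (Q - P) * P = (1 - P) * Q * P - (P - P * P) * P := by noncomm_ring
    rw [this, hP.2.1, sub_self, zero_mul, sub_zero]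
  rw [h]
  exact (hP.norm_mul_le' _).1.trans (hP.norm_mul_le _).2

/-- One step of the iteration contracts the energy of the off-diagonal block by `ρ ^ 2`. -/
lemma exists_energy_contraction {A B P : Matrix (Fin N) (Fin N) ℂ} (hn1 : 1 ≤ n) (hnN : n < N)
    (hA : A.IsHermitian) (hB : (-B).PosDef) (hgap : eig (A + B) n < eig (A + B) (n + 1))
    (hP : IsBottomEigenproj n (A + B) P) {ρ : ℝ}
    (hρ : specNorm B / (specNorm B + (eig (A + B) (n + 1) - eig (A + B) n)) < ρ) :
    ∃ C₁ δ M : ℝ, 0 < δ ∧ 0 ≤ M ∧ ∃ E : Matrix (Fin N) (Fin N) ℂ → ℝ,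
      (∀ Q, IsProjOfRank n Q → (eig (A + B) (n + 1) - eig (A + B) n) * ‖(1 - P) * Q * P‖ ^ 2 ≤
        E Q ∧ E Q ≤ M * ‖Q - P‖ ^ 2) ∧
      ∀ Q R, IsProjOfRank n Q → IsBottomEigenproj n (A + acomp B Q) R → ‖Q - P‖ < δ →
        ‖R - P‖ ≤ C₁ * ‖Q - P‖ ∧ E R ≤ ρ ^ 2 * E Q := by
  obtain ⟨K, hK0, hK⟩ := exists_re_trace_le_norm N
  obtain ⟨L, hL0, hL⟩ := exists_specNorm_le_norm N
  have hH : (A + B).IsHermitian := hA.add (by simpa using hB.1.neg)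
  have hPp := hP.1
  set H := A + B with hHdef
  set g := eig H (n + 1) - eig H n with hg
  have hg0 : 0 < g := sub_pos.mpr hgap
  set β := specNorm B with hβ
  have hβ0 : 0 ≤ β := norm_nonneg _
  have hβg : 0 < β + g := by linarith
  set γ := β / (β + g) with hγ
  have hγ0 : 0 ≤ γ := div_nonneg hβ0 hβg.le
  have hρ0 : 0 < ρ := hγ0.trans_lt hρ
  have hPker := fun x (hx : P *ᵥ x = 0) => hP.le_reQuad_of_ker hH hgap hx
  have hPran : ∀ x, P *ᵥ x = x → reQuad H x ≤ eig H n * normSqVec x :=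
    fun x hx => hP.2.2 x ⟨x, hx.symm⟩
  obtain ⟨hD₀, hD₀B, hD₀P⟩ := acomp_sub_props hB hPp
  set D₀ := acomp B P - B with hD₀def
  have hPD₀ : P * D₀ = 0 := by
    have := congrArg conjTranspose hD₀P
    rwa [conjTranspose_mul, hPp.1.eq, hD₀.1.eq, conjTranspose_zero] at this
  have hlow : ∀ Z, g * ‖(1 - P) * Z * P‖ ^ 2 + reTraceForm D₀ ((1 - P) * Z * P) ≤
      energy H D₀ ((1 - P) * Z * P) := fun Z =>
    energy_ge hPran hPker (offDiag_compl hPp).1 (offDiag_compl hPp).2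
  have hform : ∀ Z, reTraceForm D₀ ((1 - P) * Z * P) ≤ γ * energy H D₀ ((1 - P) * Z * P) := by
    intro Z
    have h1 : reTraceForm D₀ ((1 - P) * Z * P) ≤ β * ‖(1 - P) * Z * P‖ ^ 2 := by
      refine (reTraceForm_mono hD₀B).trans (reTraceForm_le fun j => ?_)
      rw [reQuad_neg]
      exact (neg_le_abs _).trans (abs_reQuad_le_specNorm _ _)
    rw [hγ, div_mul_eq_mul_div, le_div_iff₀ hβg]
    have h2 := mul_le_mul_of_nonneg_left (hlow Z) hβ0
    have h3 := mul_le_mul_of_nonneg_left h1 hg0.le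
    linarith
  have hlow' : ∀ Z, g * ‖(1 - P) * Z * P‖ ^ 2 ≤ energy H D₀ ((1 - P) * Z * P) := fun Z => by
    linarith [hlow Z, hD₀.reTraceForm_nonneg ((1 - P) * Z * P)]
  set b := ‖D₀‖ + 1 with hb
  have hb0 : 0 < b := by positivity
  set C₁ := 2 * K * b / g + 1 with hC₁
  have hC₁0 : 0 < C₁ := by positivity
  have hac : ContinuousAt (acomp B) P := continuousAt_acomp hB hPp
  have ev1 : ∀ᶠ Q in nhds P, ‖acomp B Q - B‖ < b := by
    have hc : ContinuousAt (fun Q => ‖acomp B Q - B‖) P := (hac.sub continuousAt_const).norm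
    exact hc.eventually_lt continuousAt_const (by simp [hb, hD₀def])
  have ev2 : ∀ᶠ Q in nhds P, L * (‖acomp B Q - B‖ * ‖Q - P‖ ^ 2) < g := by
    have hc : ContinuousAt (fun Q => L * (‖acomp B Q - B‖ * ‖Q - P‖ ^ 2)) P :=
      continuousAt_const.mul ((hac.sub continuousAt_const).norm.mul
        ((continuousAt_id.sub continuousAt_const).norm.pow 2))
    exact hc.eventually_lt continuousAt_const (by simpa using hg0)
  have ev3 : ∀ᶠ Q in nhds P, 16 * K * C₁ *
      (C₁ * b * ‖Q - P‖ + ‖acomp B Q - B - D₀‖ * (C₁ + 1)) < ρ * (ρ - γ) * g := by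
    have hc : ContinuousAt (fun Q => 16 * K * C₁ *
        (C₁ * b * ‖Q - P‖ + ‖acomp B Q - B - D₀‖ * (C₁ + 1))) P :=
      continuousAt_const.mul ((continuousAt_const.mul
        (continuousAt_id.sub continuousAt_const).norm).add
        (((hac.sub continuousAt_const).sub continuousAt_const).norm.mul continuousAt_const))
    refine hc.eventually_lt continuousAt_const ?_
    have : 0 < ρ * (ρ - γ) * g := mul_pos (mul_pos hρ0 (sub_pos.mpr hρ)) hg0
    simpa [hD₀def] using this
  obtain ⟨δ, hδ, hball⟩ := Metric.eventually_nhds_iff.mp (ev1.and (ev2.and ev3))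
  refine ⟨C₁, min δ (1 / 4), K * (2 * ‖H‖ + ‖D₀‖), by positivity, by positivity,
    fun Z => energy H D₀ ((1 - P) * Z * P), fun Q hQ => ⟨hlow' Q, ?_⟩, fun Q R hQ hR hd => ?_⟩
  · refine (energy_le hK0.le hK).trans (mul_le_mul_of_nonneg_left ?_ (by positivity))
    exact pow_le_pow_left₀ (norm_nonneg _) hPp.norm_offDiag_le 2
  obtain ⟨hQ1, hQ2, hQ3⟩ := hball (y := Q) (by
    rw [dist_eq_norm]; exact hd.trans_le (min_le_left _ _))
  have hdX := hPp.norm_sub_le_offDiag hQ (hd.le.trans (min_le_right _ _))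
  obtain ⟨hD, -, hDQ⟩ := acomp_sub_props hB hQ
  have hHD : A + acomp B Q = H + (acomp B Q - B) := by rw [hHdef]; abel
  rw [hHD] at hR
  set D := acomp B Q - B with hDdef
  set X := (1 - P) * Q * P with hX
  set Y := (1 - P) * R * P with hY
  have hapriori := hP.gap_mul_normSq_sub_le hn1 hnN hH hgap hQ hD hDQ hR hK hK0.le hL hL0.le hQ2
  have hr : ‖R - P‖ ≤ C₁ * ‖Q - P‖ := by
    refine le_of_sq_le_sq ?_ (by positivity)
    have h1 : ‖R - P‖ ^ 2 ≤ 2 * K * b / g * ‖Q - P‖ ^ 2 := by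
      rw [div_mul_eq_mul_div, le_div_iff₀ hg0]
      have : K * (‖D‖ * ‖Q - P‖ ^ 2) ≤ K * (b * ‖Q - P‖ ^ 2) := by gcongr
      linarith
    have h2 : 2 * K * b / g ≤ C₁ ^ 2 := by
      have : 0 ≤ 2 * K * b / g := by positivity
      rw [hC₁]
      nlinarith
    rw [mul_pow]
    exact h1.trans (mul_le_mul_of_nonneg_right h2 (sq_nonneg _))
  refine ⟨hr, ?_⟩
  set F := (1 - P) * (R - P) * D * (P - Q) * P - (1 - P) * (D - D₀) * (R - Q) * P with hF
  have hid : H * Y - Y * H + D₀ * Y = D₀ * X + F :=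
    offDiag_identity hP.2.1 hR.2.1 hDQ hD₀P hPD₀ hPp.2.1
  have hFnorm : ‖F‖ ≤ (C₁ * b * ‖Q - P‖ + ‖D - D₀‖ * (C₁ + 1)) * ‖Q - P‖ := by
    have f1 : ‖(1 - P) * (R - P) * D * (P - Q) * P‖ ≤ ‖R - P‖ * ‖D‖ * ‖Q - P‖ := by
      rw [norm_sub_rev Q P]
      refine (hPp.norm_mul_le' _).1.trans ((norm_mul_le _ _).trans ?_)
      gcongr
      refine (norm_mul_le _ _).trans ?_
      gcongr
      exact (hPp.norm_mul_le _).2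
    have f2 : ‖(1 - P) * (D - D₀) * (R - Q) * P‖ ≤ ‖D - D₀‖ * (‖R - P‖ + ‖Q - P‖) := by
      refine (hPp.norm_mul_le' _).1.trans ((norm_mul_le _ _).trans ?_)
      gcongr
      · exact (hPp.norm_mul_le _).2
      · have : R - Q = (R - P) - (Q - P) := by abel
        rw [this]
        exact norm_sub_le _ _
    calc ‖F‖ ≤ ‖R - P‖ * ‖D‖ * ‖Q - P‖ + ‖D - D₀‖ * (‖R - P‖ + ‖Q - P‖) :=
          (norm_sub_le _ _).trans (add_le_add f1 f2)
      _ ≤ (C₁ * ‖Q - P‖) * b * ‖Q - P‖ + ‖D - D₀‖ * (C₁ * ‖Q - P‖ + ‖Q - P‖) := by gcongr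
      _ = _ := by ring
  have herr : (Yᴴ * F).trace.re ≤ ρ * (ρ - γ) * energy H D₀ X := by
    have h1 : ‖Yᴴ * F‖ ≤ (C₁ * ‖Q - P‖) *
        ((C₁ * b * ‖Q - P‖ + ‖D - D₀‖ * (C₁ + 1)) * ‖Q - P‖) := by
      refine (norm_mul_le _ _).trans ?_
      rw [frobenius_norm_conjTranspose]
      gcongr
      exact hPp.norm_offDiag_le.trans hr
    have h2 : ‖Q - P‖ ^ 2 ≤ 16 * ‖X‖ ^ 2 := by
      have := pow_le_pow_left₀ (norm_nonneg _) hdX 2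
      rw [mul_pow] at this
      linarith
    calc (Yᴴ * F).trace.re ≤ K * ‖Yᴴ * F‖ := (le_abs_self _).trans (hK _)
      _ ≤ K * ((C₁ * ‖Q - P‖) *
          ((C₁ * b * ‖Q - P‖ + ‖D - D₀‖ * (C₁ + 1)) * ‖Q - P‖)) := by gcongr
      _ = K * C₁ * (C₁ * b * ‖Q - P‖ + ‖D - D₀‖ * (C₁ + 1)) * ‖Q - P‖ ^ 2 := by ring
      _ ≤ K * C₁ * (C₁ * b * ‖Q - P‖ + ‖D - D₀‖ * (C₁ + 1)) * (16 * ‖X‖ ^ 2) := by gcongr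
      _ = 16 * K * C₁ * (C₁ * b * ‖Q - P‖ + ‖D - D₀‖ * (C₁ + 1)) * ‖X‖ ^ 2 := by ring
      _ ≤ ρ * (ρ - γ) * g * ‖X‖ ^ 2 := by gcongr
      _ = ρ * (ρ - γ) * (g * ‖X‖ ^ 2) := by ring
      _ ≤ ρ * (ρ - γ) * energy H D₀ X :=
          mul_le_mul_of_nonneg_left (hlow' Q) (mul_nonneg hρ0.le (sub_nonneg.mpr hρ.le))
  have hE : energy H D₀ Y = (Yᴴ * (D₀ * X)).trace.re + (Yᴴ * F).trace.re := by
    rw [energy, hid, mul_add, trace_add, Complex.add_re]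
  have hcs := hD₀.two_mul_trace_le X Y ρ
  have hmain : (ρ - γ / 2) * energy H D₀ Y ≤ (ρ - γ / 2) * (ρ ^ 2 * energy H D₀ X) := by
    have h1 := mul_le_mul_of_nonneg_left herr hρ0.le
    have h2 := mul_le_mul_of_nonneg_left (hform Q) (sq_nonneg ρ)
    have h3 := hform R
    have h4 : ρ * energy H D₀ Y = ρ * (Yᴴ * (D₀ * X)).trace.re + ρ * (Yᴴ * F).trace.re := by
      rw [hE, mul_add]
    linarith
  exact le_of_mul_le_mul_left hmain (by linarith)

end Frobenius

/-- Linear convergence of a locally contracting scalar recursion, measured through an energy. -/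
lemma exists_geometric_bound {C₁ δ L M ρ : ℝ} (hδ : 0 < δ) (hL : 0 ≤ L) (hM : 0 ≤ M)
    (hρ0 : 0 < ρ) (hρ1 : ρ < 1) :
    ∃ C c : ℝ, 0 < C ∧ 0 < c ∧ ∀ d e : ℕ → ℝ, (∀ k, 0 ≤ d k) →
      (∀ k, d k ≤ δ → d k ^ 2 ≤ L * e k) → e 0 ≤ M * d 0 ^ 2 →
      (∀ k, d k < δ → d (k + 1) ≤ C₁ * d k ∧ e (k + 1) ≤ ρ ^ 2 * e k) →
      d 0 ≤ c → ∀ k, d k ≤ C * ρ ^ k * d 0 := by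
  set C := L * M + 1 with hC
  have hC1 : 1 ≤ C := by nlinarith [mul_nonneg hL hM]
  set δ' := min (δ / 2) (δ / (|C₁| + 1)) with hδ'
  have hδ'0 : 0 < δ' := by positivity
  refine ⟨C, δ' / C, by linarith, by positivity, fun d e hd hde he0 hstep hd0 => ?_⟩
  have hd0' : C * d 0 ≤ δ' := by rwa [le_div_iff₀' (by linarith)] at hd0
  have hgeo : ∀ k, d k ≤ δ → e k ≤ ρ ^ (2 * k) * e 0 → d k ≤ C * ρ ^ k * d 0 := by
    intro k hk hek
    have hρk : 0 < ρ ^ k := pow_pos hρ0 k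
    refine le_of_sq_le_sq ?_ (mul_nonneg (by positivity) (hd 0))
    calc d k ^ 2 ≤ L * e k := hde k hk
      _ ≤ L * (ρ ^ (2 * k) * (M * d 0 ^ 2)) := by
        gcongr
        exact hek.trans (mul_le_mul_of_nonneg_left he0 (by positivity))
      _ = (L * M) * (ρ ^ k * d 0) ^ 2 := by ring
      _ ≤ C ^ 2 * (ρ ^ k * d 0) ^ 2 := by
        gcongr
        nlinarith
      _ = _ := by ring
  have hsmall : ∀ k, d k ≤ C * ρ ^ k * d 0 → d k ≤ δ' := by
    intro k hk
    refine hk.trans (le_trans ?_ hd0')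
    refine mul_le_mul_of_nonneg_right ?_ (hd 0)
    exact mul_le_of_le_one_right (by linarith) (pow_le_one₀ hρ0.le hρ1.le)
  have hlt : δ' < δ := (min_le_left _ _).trans_lt (by linarith)
  have key : ∀ k, d k ≤ δ' ∧ e k ≤ ρ ^ (2 * k) * e 0 := by
    intro k
    induction k with
    | zero =>
      refine ⟨le_trans ?_ hd0', by simp⟩
      nlinarith [hd 0]
    | succ k ih =>
      obtain ⟨h1, h2⟩ := hstep k (ih.1.trans_lt hlt)
      have he : e (k + 1) ≤ ρ ^ (2 * (k + 1)) * e 0 := by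
        calc e (k + 1) ≤ ρ ^ 2 * e k := h2
          _ ≤ ρ ^ 2 * (ρ ^ (2 * k) * e 0) := by gcongr; exact ih.2
          _ = _ := by ring
      have hd1 : d (k + 1) ≤ δ := by
        calc d (k + 1) ≤ C₁ * d k := h1
          _ ≤ (|C₁| + 1) * (δ / (|C₁| + 1)) := by
            refine mul_le_mul ?_ (ih.1.trans (min_le_right _ _)) (hd k) (by positivity)
            linarith [le_abs_self C₁]
          _ = δ := by field_simp
      exact ⟨hsmall _ (hgeo _ hd1 he), he⟩
  exact fun k => hgeo k ((key k).1.trans hlt.le) (key k).2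

/-- **Local convergence (Theorem 2 / Theorem `convlineig`).** Let `λ_g > 0` be the
spectral gap of `A+B` at level `n`, let `P` be the bottom-`n` eigenprojector of `A+B`,
and set `γ̄ = ‖B‖₂/(‖B‖₂ + λ_g)`. For every rate `ρ ∈ (γ̄, 1)` there are constants
`C, c > 0` such that any adaptive compression iteration sequence `(P^(k))` of rank-`n`
orthogonal projectors (each `P^(k+1)` a bottom-`n` eigenprojector of `A + B̃[P^(k)]`)
starting with `‖P^(0) − P‖₂ ≤ c` satisfies
`‖P^(k) − P‖₂ ≤ C ρ^k ‖P^(0) − P‖₂` for all `k`. -/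
theorem acomp_local_convergence {N n : ℕ} (hn1 : 1 ≤ n) (hnN : n < N)
    (A B : Matrix (Fin N) (Fin N) ℂ) (hA : A.IsHermitian) (hB : (-B).PosDef)
    (hgap : eig (A + B) n < eig (A + B) (n + 1))
    (P : Matrix (Fin N) (Fin N) ℂ) (hP : IsBottomEigenproj n (A + B) P) :
    ∀ ρ : ℝ,
      specNorm B / (specNorm B + (eig (A + B) (n + 1) - eig (A + B) n)) < ρ → ρ < 1 →
      ∃ C c : ℝ, 0 < C ∧ 0 < c ∧
        ∀ Ps : ℕ → Matrix (Fin N) (Fin N) ℂ,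
          (∀ k : ℕ, IsProjOfRank n (Ps k)) →
          (∀ k : ℕ, IsBottomEigenproj n (A + acomp B (Ps k)) (Ps (k + 1))) →
          specNorm (Ps 0 - P) ≤ c →
          ∀ k : ℕ, specNorm (Ps k - P) ≤ C * ρ ^ k * specNorm (Ps 0 - P) := by
  open scoped Matrix.Norms.Frobenius in
  intro ρ hρ hρ1
  obtain ⟨K₁, hK₁, hspec⟩ := exists_specNorm_le_norm N
  obtain ⟨K₂, hK₂, hfrob⟩ := exists_norm_le_specNorm N
  obtain ⟨C₁, δ, M, hδ, hM, E, hE, hstep⟩ :=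
    exists_energy_contraction hn1 hnN hA hB hgap hP hρ
  have hg := sub_pos.mpr hgap
  set g := eig (A + B) (n + 1) - eig (A + B) n
  have hρ0 : 0 < ρ := lt_of_le_of_lt
    (div_nonneg (norm_nonneg _) (add_nonneg (norm_nonneg _) hg.le)) hρ
  obtain ⟨C, c, hC, hc, hgeo⟩ := exists_geometric_bound (C₁ := C₁) (L := 16 / g)
    (lt_min hδ (show (0 : ℝ) < 1 / 4 by norm_num)) (by positivity) hM hρ0 hρ1
  refine ⟨K₁ * C * K₂, c / K₂, by positivity, by positivity, fun Ps hPs hbot h0 k => ?_⟩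
  have h0' : ‖Ps 0 - P‖ ≤ c := by
    rw [le_div_iff₀' hK₂] at h0
    exact (hfrob _).trans h0
  have hmain := hgeo (fun k => ‖Ps k - P‖) (fun k => E (Ps k)) (fun k => norm_nonneg _)
    (fun k hk => ?_) (hE _ (hPs 0)).2
    (fun k hk => hstep _ _ (hPs k) (hbot k) (hk.trans_le (min_le_left _ _))) h0' k
  · calc specNorm (Ps k - P) ≤ K₁ * ‖Ps k - P‖ := hspec _
      _ ≤ K₁ * (C * ρ ^ k * ‖Ps 0 - P‖) := by gcongr
      _ ≤ K₁ * (C * ρ ^ k * (K₂ * specNorm (Ps 0 - P))) := by gcongr; exact hfrob _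
      _ = K₁ * C * K₂ * ρ ^ k * specNorm (Ps 0 - P) := by ring
  · have h1 := pow_le_pow_left₀ (norm_nonneg _)
      (hP.1.norm_sub_le_offDiag (hPs k) (hk.trans (min_le_right _ _))) 2
    have h2 := (hE _ (hPs k)).1
    rw [div_mul_eq_mul_div, le_div_iff₀ hg]
    nlinarith
end
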